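/- arXiv:2601.06852 — 13 statements merged into one kernel-verified Lean document; each statement's English description precedes it below -/
import Mathlib

section
/- Let A be a complex unital Banach algebra and X a Banach space equipped with an A-bimodule structure whose actions satisfy ‖a·x‖ ≤ ‖a‖·‖x‖ and ‖x·a‖ ≤ ‖x‖·‖a‖ for all a ∈ A, x ∈ X. Let ∂₀ : A₀ → X be a derivation defined on a dense unital subalgebra A₀ ⊆ A, and assume ∂₀ is closable as an unbounded operator from A to X; let ∂ denote its closure and D ⊆ A its domain. Then: (1) D is a unital subalgebra of A; (2) ∂ satisfies the Leibniz rule ∂(ab) = a·(∂b) + (∂a)·b for all a, b ∈ D; (3) the graph norm ‖a‖_Gr := ‖a‖ + ‖∂a‖ is submultiplicative on D, i.e. ‖ab‖_Gr ≤ ‖a‖_Gr·‖b‖_Gr; and (4) (D, ‖·‖_Gr) is a unital Banach algebra (in particular complete). -/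
open MulOpposite

/-- let `A` be a complex unital Banach algebra and `X` a Banach
`A`-bimodule with contractive actions.  Let `∂₀` be a derivation defined on a
dense unital subalgebra `A₀ ⊆ A`, closable as an unbounded operator from `A`
to `X`, and let `∂` (with domain `D = Dset`) be its closure, i.e. the graph
of `∂` over `Dset` is the closure of the graph of `∂₀` over `A₀`.  Then:
(1) `Dset` is a unital subalgebra of `A`; (2) `∂` satisfies the Leibniz rule
on `Dset`; (3) the graph norm `‖a‖_Gr = ‖a‖ + ‖∂a‖` is submultiplicative on
`Dset`; and (4) `Dset` is complete in the graph norm, so `(Dset, ‖·‖_Gr)` is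
a unital Banach algebra. -/
theorem statement0
    {A X : Type*} [NormedRing A] [NormOneClass A] [NormedAlgebra ℂ A]
    [CompleteSpace A]
    [NormedAddCommGroup X] [NormedSpace ℂ X] [CompleteSpace X]
    [Module A X] [Module Aᵐᵒᵖ X] [SMulCommClass A Aᵐᵒᵖ X]
    [IsScalarTower ℂ A X] [IsScalarTower ℂ Aᵐᵒᵖ X]
    -- contractivity of the bimodule actions
    (hl : ∀ (a : A) (x : X), ‖a • x‖ ≤ ‖a‖ * ‖x‖)
    (hr : ∀ (a : A) (x : X), ‖op a • x‖ ≤ ‖x‖ * ‖a‖)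
    -- the dense unital subalgebra A₀ and the derivation ∂₀ on it
    (A₀ : Subalgebra ℂ A) (hdense : Dense (A₀ : Set A))
    (del₀ : A →ₗ[ℂ] X)
    (hder : ∀ a ∈ A₀, ∀ b ∈ A₀, del₀ (a * b) = a • del₀ b + op b • del₀ a)
    -- ∂₀ is closable
    (hclosable : ∀ x : X,
      ((0 : A), x) ∈ closure {p : A × X | p.1 ∈ A₀ ∧ p.2 = del₀ p.1} → x = 0)
    -- ∂ (= del, with domain Dset) is the closure of ∂₀
    (Dset : Set A) (del : A → X)
    (hgraph : {p : A × X | p.1 ∈ Dset ∧ del p.1 = p.2} =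
      closure {p : A × X | p.1 ∈ A₀ ∧ p.2 = del₀ p.1}) :
    -- (1) Dset is a unital subalgebra of A
    ((1 : A) ∈ Dset ∧
      (∀ a ∈ Dset, ∀ b ∈ Dset, a + b ∈ Dset ∧ a * b ∈ Dset) ∧
      (∀ c : ℂ, ∀ a ∈ Dset, c • a ∈ Dset)) ∧
    -- (2) the Leibniz rule holds on Dset
    (∀ a ∈ Dset, ∀ b ∈ Dset, del (a * b) = a • del b + op b • del a) ∧
    -- (3) the graph norm is submultiplicative on Dset
    (∀ a ∈ Dset, ∀ b ∈ Dset,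
      ‖a * b‖ + ‖del (a * b)‖ ≤ (‖a‖ + ‖del a‖) * (‖b‖ + ‖del b‖)) ∧
    -- (4) Dset is complete in the graph norm
    (∀ u : ℕ → A, (∀ n, u n ∈ Dset) →
      (∀ ε : ℝ, 0 < ε → ∃ N : ℕ, ∀ m ≥ N, ∀ n ≥ N,
        ‖u m - u n‖ + ‖del (u m - u n)‖ < ε) →
      ∃ a ∈ Dset, ∀ ε : ℝ, 0 < ε → ∃ N : ℕ, ∀ n ≥ N,
        ‖u n - a‖ + ‖del (u n - a)‖ < ε) := by
  haveI : IsBoundedSMul A X := IsBoundedSMul.of_norm_smul_le hl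
  haveI : IsBoundedSMul Aᵐᵒᵖ X := IsBoundedSMul.of_norm_smul_le (fun r x => by
    have := hr r.unop x
    rw [op_unop, mul_comm] at this
    exact this)
  set G : Set (A × X) := {p : A × X | p.1 ∈ A₀ ∧ p.2 = del₀ p.1} with hG
  have toC : ∀ a ∈ Dset, (a, del a) ∈ closure G := fun a ha => by
    rw [← hgraph]; exact ⟨ha, rfl⟩
  have ofC : ∀ (a : A) (x : X), (a, x) ∈ closure G → a ∈ Dset ∧ del a = x := fun a x h => by
    rw [← hgraph] at h; exact h
  have hadd : ∀ p ∈ closure G, ∀ q ∈ closure G, p + q ∈ closure G := fun p hp q hq =>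
    map_mem_closure₂ (f := fun p q : A × X => p + q) (by fun_prop) hp hq (by
      rintro p ⟨hp1, hp2⟩ q ⟨hq1, hq2⟩
      exact ⟨A₀.add_mem hp1 hq1, by simp [hp2, hq2]⟩)
  have hsmul : ∀ (c : ℂ), ∀ p ∈ closure G, c • p ∈ closure G := fun c p hp =>
    map_mem_closure (f := fun p : A × X => c • p) (by fun_prop) hp (by
      rintro p ⟨hp1, hp2⟩
      exact ⟨A₀.smul_mem hp1 c, by simp [hp2]⟩)
  have hmul : ∀ p ∈ closure G, ∀ q ∈ closure G,
      (p.1 * q.1, p.1 • q.2 + op q.1 • p.2) ∈ closure G := fun p hp q hq =>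
    map_mem_closure₂ (f := fun p q : A × X => (p.1 * q.1, p.1 • q.2 + op q.1 • p.2))
      (by
        have h1 : Continuous fun x : (A × X) × (A × X) => op x.2.1 :=
          continuous_op.comp (by fun_prop)
        have h2 : Continuous fun x : (A × X) × (A × X) => op x.2.1 • x.1.2 :=
          h1.smul (by fun_prop)
        have h3 : Continuous fun x : (A × X) × (A × X) => x.1.1 • x.2.2 :=
          Continuous.smul (by fun_prop) (by fun_prop)
        exact Continuous.prodMk (by fun_prop) (h3.add h2)) hp hq (by
      rintro p ⟨hp1, hp2⟩ q ⟨hq1, hq2⟩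
      exact ⟨A₀.mul_mem hp1 hq1, by simp only [hp2, hq2]; exact (hder _ hp1 _ hq1).symm⟩)
  have hM : ∀ a ∈ Dset, ∀ b ∈ Dset, a * b ∈ Dset ∧ del (a * b) = a • del b + op b • del a :=
    fun a ha b hb => ofC _ _ (hmul _ (toC a ha) _ (toC b hb))
  have hS : ∀ a ∈ Dset, ∀ b ∈ Dset, del (a - b) = del a - del b := fun a ha b hb => by
    have h := hadd _ (toC a ha) _ (hsmul (-1) _ (toC b hb))
    have h' := (ofC _ _ h).2
    simpa [sub_eq_add_neg] using h'
  refine ⟨⟨(ofC 1 (del₀ 1) (subset_closure ⟨A₀.one_mem, rfl⟩)).1,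
    fun a ha b hb => ⟨(ofC _ _ (hadd _ (toC a ha) _ (toC b hb))).1, (hM a ha b hb).1⟩,
    fun c a ha => (ofC _ _ (hsmul c _ (toC a ha))).1⟩,
    fun a ha b hb => (hM a ha b hb).2, ?_, ?_⟩
  · intro a ha b hb
    rw [(hM a ha b hb).2]
    have h1 := norm_add_le (a • del b) (op b • del a)
    have h2 := hl a (del b)
    have h3 := hr b (del a)
    have h4 := norm_mul_le a b
    have h5 := mul_nonneg (norm_nonneg (del a)) (norm_nonneg (del b))
    nlinarith
  · intro u hu hc
    have hcs : CauchySeq fun n => (u n, del (u n)) := by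
      rw [Metric.cauchySeq_iff]
      intro ε hε
      obtain ⟨N, hN⟩ := hc ε hε
      refine ⟨N, fun m hm n hn => ?_⟩
      have h := hN m hm n hn
      rw [hS _ (hu m) _ (hu n)] at h
      rw [dist_eq_norm, Prod.norm_def]
      have h1 := norm_nonneg (u m - u n)
      have h2 := norm_nonneg (del (u m) - del (u n))
      exact max_lt (by simp only [Prod.fst_sub]; linarith) (by simp only [Prod.snd_sub]; linarith)
    obtain ⟨⟨a, x⟩, hlim⟩ := cauchySeq_tendsto_of_complete hcs
    have hmem : (a, x) ∈ closure G :=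
      isClosed_closure.mem_of_tendsto hlim (Filter.Eventually.of_forall fun n => toC _ (hu n))
    obtain ⟨haD, hax⟩ := ofC _ _ hmem
    refine ⟨a, haD, fun ε hε => ?_⟩
    obtain ⟨N, hN⟩ := Metric.tendsto_atTop.1 hlim (ε / 2) (half_pos hε)
    refine ⟨N, fun n hn => ?_⟩
    have h := hN n hn
    rw [dist_eq_norm, Prod.norm_def, max_lt_iff] at h
    rw [hS _ (hu n) _ haD, hax]
    have h1 : ‖u n - a‖ < ε / 2 := h.1
    have h2 : ‖del (u n) - x‖ < ε / 2 := h.2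
    linarith
end

section
/- In Setup (★), let f ∈ A₀ satisfy ‖∂f‖ < 1/M. Then the linear map φ : H → H defined by φ(v) := −I((∂f)·v) is well defined and satisfies ‖φ(v)‖_Gr ≤ M·‖∂f‖·‖v‖_Gr for all v ∈ H; in particular φ is a contraction on the Banach space (H, ‖·‖_Gr). Consequently, the equation ∂u = −(∂f)·u has no nonzero solution u ∈ H. -/
open MulOpposite

/-- Setup (★): an abstract model of the quantum projective line `ℂP¹_q`.
`A` plays the role of `C(S_q²)`, `X` that of the bounded operators `B(H₊,H₋)`,
`del` is (the closure of) the holomorphic differential `∂̄` with domain the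
dense unital subalgebra `D`, `A₀` is the coordinate algebra `O(S_q²)`,
`ψ = ψ_∞` and `Iq` is the Aguilar–Kaad quantum integral defined on the closed
subspace `X₀` with operator norm at most `M`. -/
structure StarSetup (A : Type*) (X : Type*) [NormedRing A] [NormOneClass A]
    [NormedAlgebra ℂ A] [CompleteSpace A]
    [NormedAddCommGroup X] [NormedSpace ℂ X] [CompleteSpace X]
    [Module A X] [Module Aᵐᵒᵖ X] [SMulCommClass A Aᵐᵒᵖ X]
    [IsScalarTower ℂ A X] [IsScalarTower ℂ Aᵐᵒᵖ X] where
  /-- contractivity of the left action -/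
  norm_lsmul : ∀ (a : A) (x : X), ‖a • x‖ ≤ ‖a‖ * ‖x‖
  /-- contractivity of the right action -/
  norm_rsmul : ∀ (a : A) (x : X), ‖op a • x‖ ≤ ‖x‖ * ‖a‖
  /-- the domain of `∂`, a unital subalgebra of `A` -/
  D : Subalgebra ℂ A
  dense_D : Dense (D : Set A)
  /-- the closed operator `∂` (only its values on `D` are relevant) -/
  del : A →ₗ[ℂ] X
  /-- `∂` is a closed operator -/
  closed_graph : IsClosed {p : A × X | p.1 ∈ D ∧ del p.1 = p.2}
  /-- Leibniz rule on `D` -/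
  leibniz : ∀ u ∈ D, ∀ v ∈ D, del (u * v) = u • del v + op v • del u
  /-- the unital subalgebra `A₀ ⊆ D` -/
  A₀ : Subalgebra ℂ A
  A₀_le : (A₀ : Set A) ⊆ (D : Set A)
  /-- the continuous unital character `ψ` -/
  ψ : A →ₐ[ℂ] ℂ
  ψ_cont : Continuous ψ
  /-- the closed subspace `X₀ ⊆ X` -/
  X₀ : Submodule ℂ X
  X₀_closed : IsClosed (X₀ : Set X)
  M : ℝ
  M_pos : 0 < M
  /-- the quantum integral (only its values on `X₀` are relevant) -/
  Iq : X →ₗ[ℂ] A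
  Iq_bound : ∀ x ∈ X₀, ‖Iq x‖ ≤ M * ‖x‖
  del_mem_X₀ : ∀ u ∈ D, del u ∈ X₀
  Iq_del : ∀ u ∈ D, Iq (del u) = u - ψ u • (1 : A)
  lsmul_mem_X₀ : ∀ f ∈ A₀, ∀ v ∈ D, v • del f ∈ X₀
  rsmul_mem_X₀ : ∀ f ∈ A₀, ∀ v ∈ D, op v • del f ∈ X₀
  Iq_lsmul_mem : ∀ f ∈ A₀, ∀ v ∈ D, Iq (v • del f) ∈ D
  Iq_rsmul_mem : ∀ f ∈ A₀, ∀ v ∈ D, Iq (op v • del f) ∈ D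
  del_Iq_lsmul : ∀ f ∈ A₀, ∀ v ∈ D, del (Iq (v • del f)) = v • del f
  del_Iq_rsmul : ∀ f ∈ A₀, ∀ v ∈ D, del (Iq (op v • del f)) = op v • del f
  ψ_Iq_lsmul : ∀ f ∈ A₀, ∀ v ∈ D, ψ (Iq (v • del f)) = 0
  ψ_Iq_rsmul : ∀ f ∈ A₀, ∀ v ∈ D, ψ (Iq (op v • del f)) = 0

/-- an element is *scalar* if it lies in `ℂ·1` -/
def IsScalarElem {A : Type*} [NormedRing A] [NormedAlgebra ℂ A] (a : A) : Prop :=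
  ∃ c : ℂ, a = c • (1 : A)

namespace StarSetup

variable {A : Type*} {X : Type*} [NormedRing A] [NormOneClass A]
    [NormedAlgebra ℂ A] [CompleteSpace A]
    [NormedAddCommGroup X] [NormedSpace ℂ X] [CompleteSpace X]
    [Module A X] [Module Aᵐᵒᵖ X] [SMulCommClass A Aᵐᵒᵖ X]
    [IsScalarTower ℂ A X] [IsScalarTower ℂ Aᵐᵒᵖ X]

/-- the graph norm `‖u‖_Gr = ‖u‖ + ‖∂u‖` -/
noncomputable def Gr (S : StarSetup A X) (u : A) : ℝ := ‖u‖ + ‖S.del u‖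

/-- `H = D ∩ ker ψ` -/
def Hs (S : StarSetup A X) : Set A := {a : A | a ∈ S.D ∧ S.ψ a = 0}

end StarSetup

/-- for `f ∈ A₀` with `‖∂f‖ < 1/M`, the map `φ(v) := −I((∂f)·v)`
is a well-defined contraction on `(H, ‖·‖_Gr)` with `‖φ(v)‖_Gr ≤ M‖∂f‖‖v‖_Gr`;
consequently `∂u = −(∂f)·u` has no nonzero solution in `H`. -/
theorem statement5 {A : Type*} {X : Type*} [NormedRing A] [NormOneClass A]
    [NormedAlgebra ℂ A] [CompleteSpace A]
    [NormedAddCommGroup X] [NormedSpace ℂ X] [CompleteSpace X]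
    [Module A X] [Module Aᵐᵒᵖ X] [SMulCommClass A Aᵐᵒᵖ X]
    [IsScalarTower ℂ A X] [IsScalarTower ℂ Aᵐᵒᵖ X]
    (S : StarSetup A X) (f : A) (hf : f ∈ S.A₀)
    (hsmall : ‖S.del f‖ < 1 / S.M) :
    -- φ is well defined on H
    (∀ v ∈ S.Hs, -S.Iq (op v • S.del f) ∈ S.Hs) ∧
    -- the norm bound
    (∀ v ∈ S.Hs, S.Gr (-S.Iq (op v • S.del f)) ≤ S.M * ‖S.del f‖ * S.Gr v) ∧
    -- φ is a contraction: the Lipschitz constant is < 1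
    S.M * ‖S.del f‖ < 1 ∧
    (∀ v ∈ S.Hs, ∀ w ∈ S.Hs,
      S.Gr (-S.Iq (op v • S.del f) - -S.Iq (op w • S.del f)) ≤
        S.M * ‖S.del f‖ * S.Gr (v - w)) ∧
    -- no nonzero solution of ∂u = −(∂f)·u in H
    (∀ u ∈ S.Hs, S.del u = -(op u • S.del f) → u = 0) := by
  have hM := S.M_pos
  have h1 : S.M * ‖S.del f‖ < 1 := by
    rw [lt_div_iff₀ hM] at hsmall
    linarith
  have hmem : ∀ v ∈ S.Hs, -S.Iq (op v • S.del f) ∈ S.Hs := by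
    rintro v ⟨hv, _⟩
    refine ⟨S.D.neg_mem (S.Iq_rsmul_mem f hf v hv), ?_⟩
    rw [map_neg, S.ψ_Iq_rsmul f hf v hv, neg_zero]
  have hint : ∀ v ∈ S.Hs, S.Iq (S.del v) = v := by
    rintro v ⟨hv, hv0⟩
    rw [S.Iq_del v hv, hv0, zero_smul, sub_zero]
  have hbound : ∀ v ∈ S.Hs,
      S.Gr (-S.Iq (op v • S.del f)) ≤ S.M * ‖S.del f‖ * S.Gr v := by
    intro v hvH
    have hv := hvH.1
    have e1 : ‖S.Iq (op v • S.del f)‖ ≤ S.M * ‖op v • S.del f‖ :=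
      S.Iq_bound _ (S.rsmul_mem_X₀ f hf v hv)
    have e2 := S.norm_rsmul v (S.del f)
    have e3 : ‖v‖ ≤ S.M * ‖S.del v‖ := by
      have := S.Iq_bound _ (S.del_mem_X₀ v hv)
      rwa [hint v hvH] at this
    have e4 := mul_le_mul_of_nonneg_left e2 hM.le
    have e5 := mul_le_mul_of_nonneg_left e3 (norm_nonneg (S.del f))
    unfold StarSetup.Gr
    rw [map_neg, norm_neg, norm_neg, S.del_Iq_rsmul f hf v hv]
    linarith
  refine ⟨hmem, hbound, h1, ?_, ?_⟩
  · intro v hv w hw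
    have hvw : v - w ∈ S.Hs := by
      refine ⟨S.D.sub_mem hv.1 hw.1, ?_⟩
      rw [map_sub, hv.2, hw.2, sub_zero]
    have e : -S.Iq (op v • S.del f) - -S.Iq (op w • S.del f)
        = -S.Iq (op (v - w) • S.del f) := by
      rw [op_sub, sub_smul, map_sub]
      abel
    rw [e]
    exact hbound _ hvw
  · intro u hu he
    have h2 : -S.Iq (op u • S.del f) = u := by
      rw [← map_neg, ← he, hint u hu]
    have h3 := hbound u hu
    rw [h2] at h3
    have h4 : ‖u‖ ≤ S.Gr u := by
      unfold StarSetup.Gr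
      linarith [norm_nonneg (S.del u)]
    have h5 : ‖u‖ ≤ 0 := by
      by_contra hc
      push Not at hc
      nlinarith
    exact norm_le_zero_iff.mp h5
end

section
/- In Setup (★), assume additionally ker ∂ = ℂ·1. Let f ∈ A₀ be non-scalar with ‖∂f‖ < 1/(2M). Then the map Φ : H → H, Φ(v) := I((∂f)·(1 − v)), has a unique fixed point v₀ ∈ H; this v₀ is non-scalar and satisfies ‖v₀‖ ≤ M·‖∂f‖/(1 − M·‖∂f‖) < 1 (norm of A), and g := 1 − v₀ ∈ D satisfies ∂g = −(∂f)·g and is invertible in A (its inverse lies in A). -/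
open MulOpposite

/-- assuming `ker ∂ = ℂ·1`, for non-scalar `f ∈ A₀` with
`‖∂f‖ < 1/(2M)`, the map `Φ(v) := I((∂f)·(1−v))` has a unique fixed point
`v₀ ∈ H`; it is non-scalar, `‖v₀‖ ≤ M‖∂f‖/(1−M‖∂f‖) < 1`, and `g := 1 − v₀`
satisfies `∂g = −(∂f)·g` and is invertible in `A`. -/
theorem statement6 {A : Type*} {X : Type*} [NormedRing A] [NormOneClass A]
    [NormedAlgebra ℂ A] [CompleteSpace A]
    [NormedAddCommGroup X] [NormedSpace ℂ X] [CompleteSpace X]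
    [Module A X] [Module Aᵐᵒᵖ X] [SMulCommClass A Aᵐᵒᵖ X]
    [IsScalarTower ℂ A X] [IsScalarTower ℂ Aᵐᵒᵖ X]
    (S : StarSetup A X)
    (hker : {a : A | a ∈ S.D ∧ S.del a = 0} = {a : A | IsScalarElem a})
    (f : A) (hf : f ∈ S.A₀) (hfns : ¬ IsScalarElem f)
    (hsmall : ‖S.del f‖ < 1 / (2 * S.M)) :
    ∃ v₀ ∈ S.Hs,
      -- v₀ is a fixed point of Φ
      S.Iq (op ((1 : A) - v₀) • S.del f) = v₀ ∧
      -- uniqueness of the fixed point in H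
      (∀ v ∈ S.Hs, S.Iq (op ((1 : A) - v) • S.del f) = v → v = v₀) ∧
      -- v₀ is non-scalar
      ¬ IsScalarElem v₀ ∧
      -- the norm estimates
      ‖v₀‖ ≤ S.M * ‖S.del f‖ / (1 - S.M * ‖S.del f‖) ∧
      S.M * ‖S.del f‖ / (1 - S.M * ‖S.del f‖) < 1 ∧
      -- g := 1 − v₀ solves ∂g = −(∂f)·g
      S.del ((1 : A) - v₀) = -(op ((1 : A) - v₀) • S.del f) ∧
      -- and g is invertible in A
      IsUnit ((1 : A) - v₀) := by
  set r : ℝ := S.M * ‖S.del f‖ with hr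
  have hM := S.M_pos
  have hr0 : 0 ≤ r := by positivity
  have hr2 : r < 1 / 2 := by
    have h := mul_lt_mul_of_pos_left hsmall hM
    have h2 : S.M * (1 / (2 * S.M)) = 1 / 2 := by field_simp
    linarith
  have hone : (1 : A) ∈ S.D := S.D.one_mem
  have hbd : ∀ v ∈ S.D, ‖S.Iq (op v • S.del f)‖ ≤ r * ‖v‖ := by
    intro v hv
    have h1 := S.Iq_bound _ (S.rsmul_mem_X₀ f hf v hv)
    have h2 := mul_le_mul_of_nonneg_left (S.norm_rsmul v (S.del f)) hM.le
    calc _ ≤ _ := h1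
      _ ≤ _ := h2
      _ = r * ‖v‖ := by rw [hr]; ring
  let Φ : A → A := fun v => S.Iq (op ((1 : A) - v) • S.del f)
  have hΦD : ∀ v ∈ S.D, Φ v ∈ S.D := fun v hv =>
    S.Iq_rsmul_mem f hf _ (S.D.sub_mem hone hv)
  have hcontr : ∀ v ∈ S.D, ∀ w ∈ S.D, ‖Φ v - Φ w‖ ≤ r * ‖v - w‖ := by
    intro v hv w hw
    have h : Φ v - Φ w = S.Iq (op (w - v) • S.del f) := by
      simp only [Φ]
      rw [← map_sub, ← sub_smul, ← op_sub]
      congr 3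
      abel
    rw [h, norm_sub_rev v w]
    exact hbd _ (S.D.sub_mem hw hv)
  let u : ℕ → A := fun n => Φ^[n] 0
  have hus : ∀ n, u (n + 1) = Φ (u n) := fun n => Function.iterate_succ_apply' Φ n 0
  have huD : ∀ n, u n ∈ S.D := by
    intro n
    induction n with
    | zero => exact S.D.zero_mem
    | succ n ih => rw [hus]; exact hΦD _ ih
  have hdist : ∀ n, dist (u n) (u (n + 1)) ≤ ‖u 0 - u 1‖ * r ^ n := by
    intro n
    induction n with
    | zero => simp [dist_eq_norm]
    | succ n ih =>
      rw [dist_eq_norm] at ih ⊢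
      rw [hus (n + 1)]
      nth_rewrite 1 [hus n]
      have h := hcontr _ (huD n) _ (huD (n + 1))
      have h2 := mul_le_mul_of_nonneg_left ih hr0
      calc _ ≤ _ := h
        _ ≤ _ := h2
        _ = _ := by ring
  have hcau : CauchySeq u := cauchySeq_of_le_geometric r _ (by linarith) hdist
  obtain ⟨v, hv⟩ := cauchySeq_tendsto_of_complete hcau
  have hv1 := hv.comp (Filter.tendsto_add_atTop_nat 1)
  have hdel : ∀ n, S.del (u (n + 1)) = op ((1 : A) - u n) • S.del f := by
    intro n
    rw [hus]
    exact S.del_Iq_rsmul f hf _ (S.D.sub_mem hone (huD n))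
  have hlim : Filter.Tendsto (fun n => S.del (u (n + 1))) Filter.atTop
      (nhds (op ((1 : A) - v) • S.del f)) := by
    rw [tendsto_iff_norm_sub_tendsto_zero] at hv ⊢
    have hz : Filter.Tendsto (fun n => ‖S.del f‖ * ‖u n - v‖) Filter.atTop (nhds 0) := by
      simpa using hv.const_mul ‖S.del f‖
    refine squeeze_zero (fun _ => norm_nonneg _) (fun n => ?_) hz
    rw [hdel, ← sub_smul, ← op_sub, sub_sub_sub_cancel_left, norm_sub_rev (u n) v]
    exact S.norm_rsmul _ _
  have hgraph := S.closed_graph.mem_of_tendsto (hv1.prodMk_nhds hlim)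
    (Filter.Eventually.of_forall fun n => ⟨huD (n + 1), rfl⟩)
  obtain ⟨hvD, hdv⟩ := hgraph
  simp only at hvD hdv
  have hψ : S.ψ v = 0 := by
    have h1 := (S.ψ_cont.tendsto v).comp hv1
    refine tendsto_nhds_unique h1 ?_
    have : (S.ψ ∘ (u ∘ fun a => a + 1)) = fun _ => (0 : ℂ) := by
      funext n
      simp only [Function.comp]
      rw [hus]
      exact S.ψ_Iq_rsmul f hf _ (S.D.sub_mem hone (huD n))
    rw [this]
    exact tendsto_const_nhds
  have hfix : S.Iq (op ((1 : A) - v) • S.del f) = v := by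
    rw [← hdv, S.Iq_del v hvD, hψ]
    simp
  have hker1 : S.del (1 : A) = 0 := by
    have h : (1 : A) ∈ {a : A | a ∈ S.D ∧ S.del a = 0} := by
      rw [hker]
      exact ⟨1, by simp⟩
    exact h.2
  have hnorm : ‖v‖ ≤ r / (1 - r) := by
    rw [le_div_iff₀ (by linarith)]
    have h1 := hbd _ (S.D.sub_mem hone hvD)
    rw [hfix] at h1
    have h2 : ‖(1 : A) - v‖ ≤ 1 + ‖v‖ := by
      simpa using norm_sub_le (1 : A) v
    nlinarith [mul_le_mul_of_nonneg_left h2 hr0]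
  have hlt : r / (1 - r) < 1 := by
    rw [div_lt_one (by linarith)]
    linarith
  refine ⟨v, ⟨hvD, hψ⟩, hfix, ?_, ?_, hnorm, hlt, ?_, ?_⟩
  · intro w hw hwfix
    have h := hcontr _ hw.1 _ hvD
    simp only [Φ] at h
    rw [hwfix, hfix] at h
    have h0 : ‖w - v‖ = 0 := by
      have := norm_nonneg (w - v)
      nlinarith
    exact sub_eq_zero.mp (norm_eq_zero.mp h0)
  · rintro ⟨c, hc⟩
    have hc0 : c = 0 := by
      rw [hc] at hψ
      simpa using hψ
    have hv0 : v = 0 := by rw [hc, hc0, zero_smul]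
    rw [hv0] at hdv
    have hdf : S.del f = 0 := by simpa using hdv.symm
    have hmem : f ∈ {a : A | a ∈ S.D ∧ S.del a = 0} := ⟨S.A₀_le hf, hdf⟩
    rw [hker] at hmem
    exact hfns hmem
  · rw [map_sub, hker1, hdv, zero_sub]
  · exact isUnit_one_sub_of_norm_lt_one (lt_of_le_of_lt hnorm hlt)
end

section
/- In Setup (★), let f ∈ A₀ be non-scalar with ‖∂f‖ < 1/(3M). Then there exists g ∈ D which is invertible in the Banach algebra D (both g and g⁻¹ lie in D) and satisfies ∂g = −(∂f)·g; equivalently, h := g⁻¹ ∈ D is invertible in D and satisfies ∂h = h·(∂f). (In the model ℂP¹_q this says that the holomorphic connection ∇ⁿ_{∂̄f} on the line bundle L_n is gauge equivalent to the standard connection ∇ⁿ₀.) -/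
open MulOpposite

theorem StarSetup.picard {A : Type*} {X : Type*} [NormedRing A] [NormOneClass A]
    [NormedAlgebra ℂ A] [CompleteSpace A]
    [NormedAddCommGroup X] [NormedSpace ℂ X] [CompleteSpace X]
    [Module A X] [Module Aᵐᵒᵖ X] [SMulCommClass A Aᵐᵒᵖ X]
    [IsScalarTower ℂ A X] [IsScalarTower ℂ Aᵐᵒᵖ X]
    (S : StarSetup A X) (L : A → X) (K : ℝ) (hK0 : 0 ≤ K) (hK : S.M * K < 1 / 3)
    (hsub : ∀ u v, L (u - v) = L u - L v) (hL : ∀ v, ‖L v‖ ≤ K * ‖v‖)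
    (h1 : ∀ v ∈ S.D, L v ∈ S.X₀) (h2 : ∀ v ∈ S.D, S.Iq (L v) ∈ S.D)
    (h3 : ∀ v ∈ S.D, S.del (S.Iq (L v)) = L v)
    (h4 : ∀ v ∈ S.D, S.ψ (S.Iq (L v)) = 0) :
    ∃ g ∈ S.D, S.del g = L g ∧ S.ψ g = 1 ∧ ‖1 - g‖ < 1 := by
  have hd1 : S.del 1 = 0 := by
    have := S.leibniz 1 S.D.one_mem 1 S.D.one_mem
    simpa using this
  set c := S.M * K with hc
  have hc0 : 0 ≤ c := mul_nonneg S.M_pos.le hK0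
  have hbd : ∀ v ∈ S.D, ‖S.Iq (L v)‖ ≤ c * ‖v‖ := by
    intro v hv
    calc _ ≤ S.M * ‖L v‖ := S.Iq_bound _ (h1 v hv)
      _ ≤ S.M * (K * ‖v‖) := mul_le_mul_of_nonneg_left (hL v) S.M_pos.le
      _ = _ := by rw [hc]; ring
  let G : ℕ → A := fun n => Nat.rec 1 (fun _ v => 1 + S.Iq (L v)) n
  have G0 : G 0 = 1 := rfl
  have GS : ∀ n, G (n + 1) = 1 + S.Iq (L (G n)) := fun n => rfl
  have GD : ∀ n, G n ∈ S.D := by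
    intro n
    induction n with
    | zero => exact S.D.one_mem
    | succ n ih => rw [GS]; exact S.D.add_mem S.D.one_mem (h2 _ ih)
  have Gψ : ∀ n, S.ψ (G n) = 1 := by
    intro n
    cases n with
    | zero => simp [G0]
    | succ n => rw [GS, map_add, h4 _ (GD n)]; simp
  have Gdel : ∀ n, S.del (G (n + 1)) = L (G n) := by
    intro n
    rw [GS, map_add, hd1, h3 _ (GD n), zero_add]
  have Gdist : ∀ n, dist (G n) (G (n + 1)) ≤ c * c ^ n := by
    intro n
    induction n with
    | zero =>
      rw [GS, G0, dist_eq_norm]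
      have := hbd 1 S.D.one_mem
      simpa using this
    | succ n ih =>
      have e : G (n + 1) - G (n + 1 + 1) = S.Iq (L (G n - G (n + 1))) := by
        rw [GS (n + 1), GS n, hsub, map_sub]
        abel
      rw [dist_eq_norm] at ih ⊢
      rw [e]
      calc _ ≤ c * ‖G n - G (n + 1)‖ := hbd _ (S.D.sub_mem (GD n) (GD (n + 1)))
        _ ≤ c * (c * c ^ n) := mul_le_mul_of_nonneg_left ih hc0
        _ = _ := by ring
  have hc1 : c < 1 := by linarith
  obtain ⟨g, hg⟩ := cauchySeq_tendsto_of_complete (cauchySeq_of_le_geometric c c hc1 Gdist)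
  have hdist := dist_le_of_le_geometric_of_tendsto₀ c c hc1 Gdist hg
  have hLg : Filter.Tendsto (fun n => L (G n)) Filter.atTop (nhds (L g)) := by
    rw [tendsto_iff_norm_sub_tendsto_zero] at hg ⊢
    refine squeeze_zero (fun _ => norm_nonneg _) (fun n => ?_) (by simpa using hg.const_mul K)
    rw [← hsub]
    exact hL _
  have hmem : (g, L g) ∈ {p : A × X | p.1 ∈ S.D ∧ S.del p.1 = p.2} :=
    S.closed_graph.mem_of_tendsto
      (((Filter.tendsto_add_atTop_iff_nat 1).2 hg).prodMk_nhds hLg)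
      (Filter.Eventually.of_forall fun n => ⟨GD (n + 1), Gdel n⟩)
  refine ⟨g, hmem.1, hmem.2, ?_, ?_⟩
  · have h := (S.ψ_cont.tendsto g).comp hg
    refine tendsto_nhds_unique h ?_
    have : (S.ψ ∘ G) = fun _ => 1 := funext Gψ
    rw [this]
    exact tendsto_const_nhds
  · rw [G0, dist_eq_norm] at hdist
    refine hdist.trans_lt ?_
    rw [div_lt_one (by linarith)]
    linarith

/-- for non-scalar `f ∈ A₀` with `‖∂f‖ < 1/(3M)`, there exists
`g ∈ D` invertible in the Banach algebra `D` (both `g` and `g⁻¹` lie in `D`)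
with `∂g = −(∂f)·g`; equivalently `h := g⁻¹ ∈ D` is invertible in `D` and
satisfies `∂h = h·(∂f)`. -/
theorem statement7 {A : Type*} {X : Type*} [NormedRing A] [NormOneClass A]
    [NormedAlgebra ℂ A] [CompleteSpace A]
    [NormedAddCommGroup X] [NormedSpace ℂ X] [CompleteSpace X]
    [Module A X] [Module Aᵐᵒᵖ X] [SMulCommClass A Aᵐᵒᵖ X]
    [IsScalarTower ℂ A X] [IsScalarTower ℂ Aᵐᵒᵖ X]
    (S : StarSetup A X) (f : A) (hf : f ∈ S.A₀)
    (hfns : ¬ IsScalarElem f) (hsmall : ‖S.del f‖ < 1 / (3 * S.M)) :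
    ∃ g g' : A, g ∈ S.D ∧ g' ∈ S.D ∧ g * g' = 1 ∧ g' * g = 1 ∧
      S.del g = -(op g • S.del f) ∧ S.del g' = g' • S.del f := by
  have hK : S.M * ‖S.del f‖ < 1 / 3 := by
    have := S.M_pos
    rw [lt_div_iff₀ (by positivity)] at hsmall
    linarith
  obtain ⟨g, gD, gd, gψ, gn⟩ := S.picard (fun v => -(op v • S.del f)) ‖S.del f‖
    (norm_nonneg _) hK (fun u v => by rw [op_sub, sub_smul]; abel)
    (fun v => by rw [norm_neg]; exact S.norm_rsmul _ _)
    (fun v hv => S.X₀.neg_mem (S.rsmul_mem_X₀ f hf v hv))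
    (fun v hv => by rw [map_neg]; exact S.D.neg_mem (S.Iq_rsmul_mem f hf v hv))
    (fun v hv => by rw [map_neg, map_neg, S.del_Iq_rsmul f hf v hv])
    (fun v hv => by rw [map_neg, map_neg, S.ψ_Iq_rsmul f hf v hv, neg_zero])
  obtain ⟨h, hD, hd, hψ, hn⟩ := S.picard (fun v => v • S.del f) ‖S.del f‖
    (norm_nonneg _) hK (fun u v => sub_smul _ _ _)
    (fun v => by rw [mul_comm]; exact S.norm_lsmul _ _)
    (S.lsmul_mem_X₀ f hf) (S.Iq_lsmul_mem f hf) (S.del_Iq_lsmul f hf) (S.ψ_Iq_lsmul f hf)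
  have hdel : S.del (h * g) = 0 := by
    rw [S.leibniz h hD g gD, gd, hd, smul_neg, smul_comm, neg_add_cancel]
  have hhg : h * g = 1 := by
    have := S.Iq_del (h * g) (S.D.mul_mem hD gD)
    rw [hdel, map_zero, map_mul, hψ, gψ, mul_one, one_smul] at this
    exact (sub_eq_zero.1 this.symm)
  have hu : IsUnit g := by
    have := isUnit_one_sub_of_norm_lt_one gn
    rwa [sub_sub_cancel] at this
  have hgh : g * h = 1 := by
    obtain ⟨u, rfl⟩ := hu
    rw [Units.eq_inv_of_mul_eq_one_right hhg, Units.mul_inv]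
  exact ⟨g, h, gD, hD, hgh, hhg, gd, hd⟩
end

section
/- In Setup (★), let f, h ∈ A₀ be such that h − f is non-scalar, and define Ψ : H → H by Ψ(v) := I(v·(∂f) − (∂h)·v + ∂(h − f)). Then Ψ is well defined, and for v₀ ∈ H the following are equivalent: (i) Ψ(v₀) = v₀; (ii) ∂v₀ = v₀·(∂f) − (∂h)·v₀ + ∂(h − f); (iii) g₀ := v₀ − 1 is a nonzero element of D satisfying the mixed gauge equation ∂g₀ = g₀·(∂f) − (∂h)·g₀, and ψ(g₀) = −1. -/
open MulOpposite

/-- for `f, h ∈ A₀` with `h − f` non-scalar, the map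
`Ψ(v) := I(v·(∂f) − (∂h)·v + ∂(h−f))` is well defined `H → H`, and for
`v₀ ∈ H` the following are equivalent: (i) `Ψ(v₀) = v₀`;
(ii) `∂v₀ = v₀·(∂f) − (∂h)·v₀ + ∂(h−f)`; (iii) `g₀ := v₀ − 1` is a nonzero
element of `D` satisfying the mixed gauge equation with `ψ(g₀) = −1`. -/
theorem statement8 {A : Type*} {X : Type*} [NormedRing A] [NormOneClass A]
    [NormedAlgebra ℂ A] [CompleteSpace A]
    [NormedAddCommGroup X] [NormedSpace ℂ X] [CompleteSpace X]
    [Module A X] [Module Aᵐᵒᵖ X] [SMulCommClass A Aᵐᵒᵖ X]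
    [IsScalarTower ℂ A X] [IsScalarTower ℂ Aᵐᵒᵖ X]
    (S : StarSetup A X) (f h : A) (hf : f ∈ S.A₀) (hh : h ∈ S.A₀)
    (hns : ¬ IsScalarElem (h - f)) :
    -- Ψ is well defined on H
    (∀ v ∈ S.Hs, S.Iq (v • S.del f - op v • S.del h + S.del (h - f)) ∈ S.Hs) ∧
    -- the three-fold equivalence
    (∀ v₀ ∈ S.Hs,
      ((S.Iq (v₀ • S.del f - op v₀ • S.del h + S.del (h - f)) = v₀) ↔
        (S.del v₀ = v₀ • S.del f - op v₀ • S.del h + S.del (h - f))) ∧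
      ((S.del v₀ = v₀ • S.del f - op v₀ • S.del h + S.del (h - f)) ↔
        (v₀ - 1 ≠ 0 ∧ v₀ - 1 ∈ S.D ∧
          S.del (v₀ - 1) = (v₀ - 1) • S.del f - op (v₀ - 1) • S.del h ∧
          S.ψ (v₀ - 1) = -1))) := by
  have h1D : (1 : A) ∈ S.D := S.D.one_mem
  have hd1 : S.del 1 = 0 := by
    have := S.leibniz 1 h1D 1 h1D
    rw [mul_one, op_one, one_smul, one_smul] at this
    simpa using this
  have hfD : f ∈ S.D := S.A₀_le hf
  have hhD : h ∈ S.D := S.A₀_le hh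
  have hsub : h - f ∈ S.D := S.D.sub_mem hhD hfD
  have hIsub : S.Iq (S.del (h - f)) ∈ S.D := by
    rw [S.Iq_del _ hsub]
    exact S.D.sub_mem hsub (S.D.smul_mem h1D _)
  have hψsub : S.ψ (S.Iq (S.del (h - f))) = 0 := by
    rw [S.Iq_del _ hsub]
    simp
  have hdsub : S.del (S.Iq (S.del (h - f))) = S.del (h - f) := by
    rw [S.Iq_del _ hsub, map_sub S.del (h - f), map_smul S.del, hd1, smul_zero, sub_zero]
  refine ⟨?_, ?_⟩
  · rintro v ⟨hv, -⟩
    rw [map_add, map_sub]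
    refine ⟨S.D.add_mem (S.D.sub_mem (S.Iq_lsmul_mem f hf v hv) (S.Iq_rsmul_mem h hh v hv))
      hIsub, ?_⟩
    rw [map_add, map_sub, S.ψ_Iq_lsmul f hf v hv, S.ψ_Iq_rsmul h hh v hv, hψsub]
    simp
  · rintro v ⟨hv, hψ⟩
    refine ⟨⟨fun H => ?_, fun H => ?_⟩, ?_⟩
    · have H2 := congrArg S.del H
      rw [map_add S.Iq, map_sub S.Iq, map_add S.del, map_sub S.del, S.del_Iq_lsmul f hf v hv,
        S.del_Iq_rsmul h hh v hv, hdsub] at H2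
      exact H2.symm
    · rw [← H, S.Iq_del v hv, hψ, zero_smul, sub_zero]
    · have hψ1 : S.ψ (v - 1) = -1 := by rw [map_sub, hψ, map_one, zero_sub]
      have key : (v - 1) • S.del f - op (v - 1) • S.del h
          = v • S.del f - op v • S.del h + S.del (h - f) := by
        rw [op_sub, op_one, sub_smul, sub_smul, one_smul, one_smul, map_sub]
        abel
      have hl : S.del (v - 1) = S.del v := by rw [map_sub, hd1, sub_zero]
      rw [key, hl]
      refine ⟨fun H => ⟨fun h0 => ?_, S.D.sub_mem hv h1D, H, hψ1⟩, fun H => H.2.2.1⟩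
      rw [h0, map_zero] at hψ1
      norm_num at hψ1
end

section
/- In Setup (★), assume additionally ker ∂ = ℂ·1. Let f, h ∈ A₀ satisfy ‖∂f‖ + ‖∂h‖ < 1/M. Then the map Ψ : H → H, Ψ(v) := I(v·(∂f) − (∂h)·v + ∂(h − f)), is a contraction on (H, ‖·‖_Gr) and hence has a unique fixed point v₀; consequently the mixed gauge equation ∂g = g·(∂f) − (∂h)·g has a solution g₀ := v₀ − 1 ∈ D with ψ(g₀) = −1. Moreover, if f − h is non-scalar, then g₀ is non-scalar. -/
open MulOpposite

/-- assuming `ker ∂ = ℂ·1`, if `f, h ∈ A₀` satisfy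
`‖∂f‖ + ‖∂h‖ < 1/M` then `Ψ(v) := I(v·(∂f) − (∂h)·v + ∂(h−f))` is a
contraction on `(H, ‖·‖_Gr)`, hence has a unique fixed point `v₀`;
consequently the mixed gauge equation has the solution `g₀ := v₀ − 1 ∈ D`
with `ψ(g₀) = −1`, and if `f − h` is non-scalar then `g₀` is non-scalar. -/
theorem statement9 {A : Type*} {X : Type*} [NormedRing A] [NormOneClass A]
    [NormedAlgebra ℂ A] [CompleteSpace A]
    [NormedAddCommGroup X] [NormedSpace ℂ X] [CompleteSpace X]
    [Module A X] [Module Aᵐᵒᵖ X] [SMulCommClass A Aᵐᵒᵖ X]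
    [IsScalarTower ℂ A X] [IsScalarTower ℂ Aᵐᵒᵖ X]
    (S : StarSetup A X)
    (hker : {a : A | a ∈ S.D ∧ S.del a = 0} = {a : A | IsScalarElem a})
    (f h : A) (hf : f ∈ S.A₀) (hh : h ∈ S.A₀)
    (hsmall : ‖S.del f‖ + ‖S.del h‖ < 1 / S.M) :
    -- Ψ is well defined on H
    (∀ v ∈ S.Hs, S.Iq (v • S.del f - op v • S.del h + S.del (h - f)) ∈ S.Hs) ∧
    -- Ψ is a contraction with constant M(‖∂f‖+‖∂h‖) < 1
    S.M * (‖S.del f‖ + ‖S.del h‖) < 1 ∧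
    (∀ v ∈ S.Hs, ∀ w ∈ S.Hs,
      S.Gr (S.Iq (v • S.del f - op v • S.del h + S.del (h - f)) -
            S.Iq (w • S.del f - op w • S.del h + S.del (h - f))) ≤
        S.M * (‖S.del f‖ + ‖S.del h‖) * S.Gr (v - w)) ∧
    -- unique fixed point and the resulting solution of the mixed gauge equation
    (∃ v₀ ∈ S.Hs,
      S.Iq (v₀ • S.del f - op v₀ • S.del h + S.del (h - f)) = v₀ ∧
      (∀ v ∈ S.Hs, S.Iq (v • S.del f - op v • S.del h + S.del (h - f)) = v → v = v₀) ∧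
      v₀ - 1 ∈ S.D ∧
      S.del (v₀ - 1) = (v₀ - 1) • S.del f - op (v₀ - 1) • S.del h ∧
      S.ψ (v₀ - 1) = -1 ∧
      (¬ IsScalarElem (f - h) → ¬ IsScalarElem (v₀ - 1))) := by
  have hM := S.M_pos
  have hfD : f ∈ S.D := S.A₀_le hf
  have hhD : h ∈ S.D := S.A₀_le hh
  have hdel1 : S.del 1 = 0 := by
    have := S.leibniz 1 S.D.one_mem 1 S.D.one_mem
    simpa using this
  set c : ℝ := ‖S.del f‖ + ‖S.del h‖ with hc
  have hc0 : 0 ≤ c := by positivity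
  have hMc : S.M * c < 1 := by
    rw [lt_div_iff₀ hM] at hsmall
    linarith
  have hhf : h - f ∈ S.D := S.D.sub_mem hhD hfD
  have hIhf : S.Iq (S.del (h - f)) ∈ S.D := by
    rw [S.Iq_del _ hhf]
    exact S.D.sub_mem hhf (S.D.smul_mem S.D.one_mem _)
  -- ∂ Ψ
  have hdelΨ : ∀ v ∈ S.D, S.del (S.Iq (v • S.del f - op v • S.del h + S.del (h - f))) =
      v • S.del f - op v • S.del h + S.del (h - f) := by
    intro v hv
    rw [map_add, map_sub, map_add, map_sub, S.del_Iq_lsmul f hf v hv,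
      S.del_Iq_rsmul h hh v hv, S.Iq_del _ hhf, map_sub S.del (h - f), map_smul, hdel1, smul_zero,
      sub_zero]
  have hmaps : ∀ v ∈ S.Hs, S.Iq (v • S.del f - op v • S.del h + S.del (h - f)) ∈ S.Hs := by
    rintro v ⟨hv, -⟩
    refine ⟨?_, ?_⟩
    · rw [map_add, map_sub]
      exact S.D.add_mem (S.D.sub_mem (S.Iq_lsmul_mem f hf v hv) (S.Iq_rsmul_mem h hh v hv)) hIhf
    · rw [map_add, map_sub, map_add, map_sub, S.ψ_Iq_lsmul f hf v hv, S.ψ_Iq_rsmul h hh v hv,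
        S.Iq_del _ hhf, map_sub S.ψ (h - f), map_smul, map_one]
      simp
  have hnorm : ∀ u : A, ‖u • S.del f - op u • S.del h‖ ≤ c * ‖u‖ := by
    intro u
    have h1 := S.norm_lsmul u (S.del f)
    have h2 := S.norm_rsmul u (S.del h)
    have h3 := norm_sub_le (u • S.del f) (op u • S.del h)
    rw [hc]
    linarith
  have hHle : ∀ u ∈ S.Hs, ‖u‖ ≤ S.M * ‖S.del u‖ := by
    rintro u ⟨hu, hu0⟩
    have := S.Iq_bound _ (S.del_mem_X₀ u hu)
    rwa [S.Iq_del u hu, hu0, zero_smul, sub_zero] at this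
  have hHsub : ∀ v ∈ S.Hs, ∀ w ∈ S.Hs, v - w ∈ S.Hs := by
    rintro v ⟨hv, hv0⟩ w ⟨hw, hw0⟩
    exact ⟨S.D.sub_mem hv hw, by rw [map_sub, hv0, hw0, sub_zero]⟩
  have hdiff : ∀ v w : A, (v • S.del f - op v • S.del h + S.del (h - f)) -
      (w • S.del f - op w • S.del h + S.del (h - f)) =
      (v - w) • S.del f - op (v - w) • S.del h := by
    intro v w
    rw [op_sub, sub_smul, sub_smul]
    abel
  have hA : ∀ v ∈ S.Hs, ∀ w ∈ S.Hs,
      ‖S.Iq (v • S.del f - op v • S.del h + S.del (h - f)) -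
            S.Iq (w • S.del f - op w • S.del h + S.del (h - f))‖ ≤ S.M * c * ‖v - w‖ := by
    intro v hv w hw
    have hvw := hHsub v hv w hw
    rw [← map_sub, hdiff]
    have h1 := S.Iq_bound _ (S.X₀.sub_mem (S.lsmul_mem_X₀ f hf _ hvw.1)
      (S.rsmul_mem_X₀ h hh _ hvw.1))
    have h2 := mul_le_mul_of_nonneg_left (hnorm (v - w)) hM.le
    linarith
  have hB : ∀ v ∈ S.Hs, ∀ w ∈ S.Hs,
      ‖S.del (S.Iq (v • S.del f - op v • S.del h + S.del (h - f)) -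
            S.Iq (w • S.del f - op w • S.del h + S.del (h - f)))‖ ≤
        S.M * c * ‖S.del (v - w)‖ := by
    intro v hv w hw
    have hvw := hHsub v hv w hw
    rw [map_sub, hdelΨ v hv.1, hdelΨ w hw.1, hdiff]
    have h2 := mul_le_mul_of_nonneg_left (hHle _ hvw) hc0
    have h3 := hnorm (v - w)
    linarith
  refine ⟨hmaps, hMc, ?_, ?_⟩
  · intro v hv w hw
    have h1 := hA v hv w hw
    have h2 := hB v hv w hw
    unfold StarSetup.Gr
    linarith
  -- the complete space
  let G : Set (A × X) := {p | p.1 ∈ S.D ∧ S.del p.1 = p.2} ∩ {p | S.ψ p.1 = 0}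
  have hG : IsClosed G :=
    S.closed_graph.inter (isClosed_eq (S.ψ_cont.comp continuous_fst) continuous_const)
  have : CompleteSpace G := hG.completeSpace_coe
  have : Nonempty G := ⟨⟨(0, 0), ⟨S.D.zero_mem, by simp⟩, by simp⟩⟩
  have hGH : ∀ p : G, p.1.1 ∈ S.Hs := fun p => ⟨p.2.1.1, p.2.2⟩
  let T : G → G := fun p =>
    ⟨(S.Iq (p.1.1 • S.del f - op p.1.1 • S.del h + S.del (h - f)),
      S.del (S.Iq (p.1.1 • S.del f - op p.1.1 • S.del h + S.del (h - f)))),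
      ⟨(hmaps _ (hGH p)).1, rfl⟩, (hmaps _ (hGH p)).2⟩
  have hMc0 : 0 ≤ S.M * c := by positivity
  have hT : ContractingWith ⟨S.M * c, hMc0⟩ T := by
    refine ⟨by exact_mod_cast hMc, LipschitzWith.of_dist_le_mul ?_⟩
    intro p q
    have h1 := hA _ (hGH p) _ (hGH q)
    have h2 := hB _ (hGH p) _ (hGH q)
    rw [map_sub, map_sub S.del p.1.1 q.1.1, p.2.1.2, q.2.1.2] at h2
    rw [Subtype.dist_eq, Subtype.dist_eq, Prod.dist_eq, Prod.dist_eq]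
    simp only [dist_eq_norm]
    refine max_le (h1.trans ?_) (h2.trans ?_)
    · exact mul_le_mul_of_nonneg_left (le_max_left _ _) hMc0
    · exact mul_le_mul_of_nonneg_left (le_max_right _ _) hMc0
  obtain ⟨v₀, hv₀, hfix⟩ : ∃ v₀ ∈ S.Hs,
      S.Iq (v₀ • S.del f - op v₀ • S.del h + S.del (h - f)) = v₀ := by
    refine ⟨_, hGH (ContractingWith.fixedPoint T hT), ?_⟩
    have := hT.fixedPoint_isFixedPt
    exact congrArg (fun p : G => p.1.1) this
  have hdelv : S.del (v₀ - 1) = (v₀ - 1) • S.del f - op (v₀ - 1) • S.del h := by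
    have := hdelΨ v₀ hv₀.1
    rw [hfix] at this
    rw [map_sub, hdel1, sub_zero, this, op_sub, sub_smul, sub_smul, op_one, one_smul, one_smul,
      map_sub]
    abel
  have hψ : S.ψ (v₀ - 1) = -1 := by
    rw [map_sub, hv₀.2, map_one, zero_sub]
  refine ⟨v₀, hv₀, hfix, ?_, S.D.sub_mem hv₀.1 S.D.one_mem, hdelv, hψ, ?_⟩
  · intro v hv hvfix
    have h1 := hA v hv v₀ hv₀
    rw [hvfix, hfix] at h1
    have h2 : ‖v - v₀‖ = 0 := by
      have := norm_nonneg (v - v₀)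
      nlinarith
    exact sub_eq_zero.mp (norm_eq_zero.mp h2)
  · rintro hns ⟨k, hk⟩
    apply hns
    have hk1 : k = -1 := by
      rw [hk, map_smul, map_one] at hψ
      simpa using hψ
    have hg : v₀ - 1 = -1 := by rw [hk, hk1, neg_one_smul]
    rw [hg, map_neg, hdel1, op_neg, op_one, neg_smul, neg_smul, one_smul, one_smul] at hdelv
    have hmem : f - h ∈ {a : A | a ∈ S.D ∧ S.del a = 0} := by
      refine ⟨S.D.sub_mem hfD hhD, ?_⟩
      rw [map_sub, ← neg_eq_zero, ← neg_zero, hdelv]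
      abel
    rw [hker] at hmem
    exact hmem
end

section
/- In Setup (★), let f, h ∈ A₀ be such that h − f is non-scalar and ‖∂h‖ + ‖∂f‖ < (1 − ‖h − f − ψ(h − f)·1‖)/M (norm of A). Then there exists g₀ ∈ D satisfying the mixed gauge equation ∂g₀ = g₀·(∂f) − (∂h)·g₀ such that g₀ is invertible in A, i.e. g₀⁻¹ exists in A. -/
open MulOpposite

/-- for `f, h ∈ A₀` with `h − f` non-scalar and
`‖∂h‖ + ‖∂f‖ < (1 − ‖h − f − ψ(h−f)·1‖)/M`, the mixed gauge equation
`∂g = g·(∂f) − (∂h)·g` has a solution `g₀ ∈ D` which is invertible in `A`. -/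
theorem statement10 {A : Type*} {X : Type*} [NormedRing A] [NormOneClass A]
    [NormedAlgebra ℂ A] [CompleteSpace A]
    [NormedAddCommGroup X] [NormedSpace ℂ X] [CompleteSpace X]
    [Module A X] [Module Aᵐᵒᵖ X] [SMulCommClass A Aᵐᵒᵖ X]
    [IsScalarTower ℂ A X] [IsScalarTower ℂ Aᵐᵒᵖ X]
    (S : StarSetup A X) (f h : A) (hf : f ∈ S.A₀) (hh : h ∈ S.A₀)
    (hns : ¬ IsScalarElem (h - f))
    (hsmall : ‖S.del h‖ + ‖S.del f‖ <
      (1 - ‖h - f - S.ψ (h - f) • (1 : A)‖) / S.M) :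
    ∃ g₀ ∈ S.D, S.del g₀ = g₀ • S.del f - op g₀ • S.del h ∧ IsUnit g₀ := by
  have hfD : f ∈ S.D := S.A₀_le hf
  have hhD : h ∈ S.D := S.A₀_le hh
  have d1 : S.del 1 = 0 := by
    have := S.leibniz 1 S.D.one_mem 1 S.D.one_mem
    simpa using this
  set c : ℝ := ‖h - f - S.ψ (h - f) • (1 : A)‖ with hc
  set k : ℝ := S.M * (‖S.del h‖ + ‖S.del f‖) with hk
  have hk0 : 0 ≤ k := mul_nonneg S.M_pos.le (by positivity)
  have hkc : k < 1 - c := by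
    have := (lt_div_iff₀ S.M_pos).1 hsmall
    rw [hk, mul_comm]; exact this
  have hc0 : 0 ≤ c := norm_nonneg _
  let Y : A → X := fun v => v • S.del f - op v • S.del h
  have Yadd : ∀ a b, Y (a + b) = Y a + Y b := by
    intro a b; simp only [Y, add_smul, op_add]; abel
  have Y0 : Y 0 = 0 := by simp [Y]
  have Yneg : ∀ a, Y (-a) = - Y a := by
    intro a; simp only [Y, neg_smul, op_neg]; abel
  let K : ℝ := ‖S.del h‖ + ‖S.del f‖
  have Ybd : ∀ a, ‖Y a‖ ≤ K * ‖a‖ := by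
    intro a
    have h1 := S.norm_lsmul a (S.del f)
    have h2 := S.norm_rsmul a (S.del h)
    have h3 := norm_sub_le (a • S.del f) (op a • S.del h)
    simp only [Y, K]; nlinarith
  let Yh : A →+ X := ⟨⟨Y, Y0⟩, Yadd⟩
  have Ycont : Continuous Y := AddMonoidHomClass.continuous_of_bound Yh K Ybd
  have YX : ∀ a ∈ S.D, Y a ∈ S.X₀ := fun a ha =>
    S.X₀.sub_mem (S.lsmul_mem_X₀ f hf a ha) (S.rsmul_mem_X₀ h hh a ha)
  have YD : ∀ a ∈ S.D, S.Iq (Y a) ∈ S.D := fun a ha => by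
    simp only [Y, map_sub]
    exact S.D.sub_mem (S.Iq_lsmul_mem f hf a ha) (S.Iq_rsmul_mem h hh a ha)
  have dY : ∀ a ∈ S.D, S.del (S.Iq (Y a)) = Y a := fun a ha => by
    simp only [Y, map_sub]
    rw [S.del_Iq_lsmul f hf a ha, S.del_Iq_rsmul h hh a ha]
  let T : A → A := fun a => S.Iq (Y a)
  let u : ℕ → A := fun n => T^[n] 1
  have us : ∀ n, u (n + 1) = S.Iq (Y (u n)) := fun n => Function.iterate_succ_apply' T n 1
  have u0 : u 0 = 1 := rfl
  have uD : ∀ n, u n ∈ S.D := by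
    intro n
    induction n with
    | zero => exact S.D.one_mem
    | succ n ih => rw [us]; exact YD _ ih
  have ubd : ∀ n, ‖u (n + 1)‖ ≤ c * k ^ n := by
    intro n
    induction n with
    | zero =>
      have : u 1 = -(h - f - S.ψ (h - f) • (1 : A)) := by
        rw [us 0, u0]
        have e : Y 1 = - S.del (h - f) := by simp [Y]
        rw [e, map_neg, S.Iq_del _ (S.D.sub_mem hhD hfD)]
      rw [zero_add, this, norm_neg, pow_zero, mul_one]
    | succ n ih =>
      rw [us]
      calc ‖S.Iq (Y (u (n + 1)))‖ ≤ S.M * ‖Y (u (n + 1))‖ := S.Iq_bound _ (YX _ (uD _))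
        _ ≤ S.M * (K * ‖u (n + 1)‖) := mul_le_mul_of_nonneg_left (Ybd _) S.M_pos.le
        _ = k * ‖u (n + 1)‖ := by simp only [hk, K]; ring
        _ ≤ k * (c * k ^ n) := mul_le_mul_of_nonneg_left ih hk0
        _ = c * k ^ (n + 1) := by ring
  have hgeo : HasSum (fun n => c * k ^ n) (c * (1 - k)⁻¹) :=
    (hasSum_geometric_of_lt_one hk0 (by linarith)).mul_left c
  have hsum1 : Summable (fun n => u (n + 1)) := Summable.of_norm_bounded hgeo.summable ubd
  have hsum : Summable u := (summable_nat_add_iff 1).1 hsum1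
  have hlim := hsum.hasSum.tendsto_sum_nat
  set g := ∑' n, u n with hg
  have hlim1 := (Filter.tendsto_add_atTop_iff_nat 1).2 hlim
  have hYlim := (Ycont.tendsto g).comp hlim
  have hmem : (g, Y g) ∈ {p : A × X | p.1 ∈ S.D ∧ S.del p.1 = p.2} := by
    refine S.closed_graph.mem_of_tendsto (hlim1.prodMk_nhds hYlim)
      (Filter.Eventually.of_forall fun n => ?_)
    have hs : ∑ i ∈ Finset.range (n + 1), u i ∈ S.D := S.D.sum_mem fun i _ => uD i
    refine ⟨hs, ?_⟩
    have e : Y (∑ i ∈ Finset.range n, u i) = ∑ i ∈ Finset.range n, Y (u i) := map_sum Yh _ _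
    simp only [Function.comp_apply, e]
    rw [Finset.sum_range_succ', map_add, u0, d1, add_zero, map_sum]
    exact Finset.sum_congr rfl fun i _ => by rw [us, dY _ (uD i)]
  refine ⟨g, hmem.1, hmem.2, ?_⟩
  have e : g = 1 + ∑' n, u (n + 1) := by rw [hg, hsum.tsum_eq_zero_add, u0]
  have hn : ‖∑' n, u (n + 1)‖ ≤ c * (1 - k)⁻¹ := tsum_of_norm_bounded hgeo ubd
  have hlt : c * (1 - k)⁻¹ < 1 := by
    rw [← div_eq_mul_inv, div_lt_one (by linarith)]; linarith
  have := isUnit_one_sub_of_norm_lt_one (x := -∑' n, u (n + 1))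
    (by rw [norm_neg]; exact hn.trans_lt hlt)
  rw [sub_neg_eq_add, ← e] at this
  exact this
end

section
/- In Setup (★), let f, h ∈ A₀ be such that h − f is non-scalar and ‖∂f‖ + ‖∂h‖ < min{ 1/3, (1 − 2·‖h − f − ψ(h − f)·1‖)/M } (norm of A in the second expression). Then there exists g ∈ D which is invertible in the Banach algebra D (both g and g⁻¹ lie in D) and satisfies the mixed gauge equation ∂g = g·(∂f) − (∂h)·g. (In the model ℂP¹_q this says that the holomorphic connections ∇ⁿ_{∂̄f} and ∇ⁿ_{∂̄h} on the line bundle L_n are gauge equivalent.) -/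
open MulOpposite

theorem star_hasSum
    {A : Type*} {X : Type*} [NormedRing A] [NormOneClass A]
    [NormedAlgebra ℂ A] [CompleteSpace A]
    [NormedAddCommGroup X] [NormedSpace ℂ X] [CompleteSpace X]
    [Module A X] [Module Aᵐᵒᵖ X] [SMulCommClass A Aᵐᵒᵖ X]
    [IsScalarTower ℂ A X] [IsScalarTower ℂ Aᵐᵒᵖ X]
    (S : StarSetup A X) (a : ℕ → A) (ha : ∀ n, a n ∈ S.D) (s : A) (y : X)
    (h1 : HasSum a s) (h2 : HasSum (fun n => S.del (a n)) y) :
    s ∈ S.D ∧ S.del s = y := by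
  have h3 : Filter.Tendsto
      (fun F : Finset ℕ => (∑ n ∈ F, a n, ∑ n ∈ F, S.del (a n)))
      Filter.atTop (nhds (s, y)) := Filter.Tendsto.prodMk_nhds h1 h2
  have := S.closed_graph.mem_of_tendsto h3 (Filter.Eventually.of_forall fun F => by
    refine ⟨S.D.sum_mem fun n _ => ha n, ?_⟩
    simp [map_sum])
  exact this

theorem star_hasSum_lsmul
    {A : Type*} {X : Type*} [NormedRing A] [NormOneClass A]
    [NormedAlgebra ℂ A] [CompleteSpace A]
    [NormedAddCommGroup X] [NormedSpace ℂ X] [CompleteSpace X]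
    [Module A X] [Module Aᵐᵒᵖ X] [SMulCommClass A Aᵐᵒᵖ X]
    [IsScalarTower ℂ A X] [IsScalarTower ℂ Aᵐᵒᵖ X]
    (S : StarSetup A X) (a : ℕ → A) (s : A) (x : X)
    (h1 : HasSum a s) : HasSum (fun n => a n • x) (s • x) := by
  let φ : A →+ X := { toFun := fun a => a • x, map_zero' := zero_smul A x,
                      map_add' := fun a b => add_smul a b x }
  have hc : Continuous φ := AddMonoidHomClass.continuous_of_bound φ ‖x‖ fun a => by
    rw [mul_comm]; exact S.norm_lsmul a x
  exact h1.map φ hc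

theorem star_hasSum_rsmul
    {A : Type*} {X : Type*} [NormedRing A] [NormOneClass A]
    [NormedAlgebra ℂ A] [CompleteSpace A]
    [NormedAddCommGroup X] [NormedSpace ℂ X] [CompleteSpace X]
    [Module A X] [Module Aᵐᵒᵖ X] [SMulCommClass A Aᵐᵒᵖ X]
    [IsScalarTower ℂ A X] [IsScalarTower ℂ Aᵐᵒᵖ X]
    (S : StarSetup A X) (a : ℕ → A) (s : A) (x : X)
    (h1 : HasSum a s) : HasSum (fun n => op (a n) • x) (op s • x) := by
  let φ : A →+ X := { toFun := fun a => op a • x,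
                      map_zero' := by rw [op_zero, zero_smul],
                      map_add' := fun a b => by rw [op_add, add_smul] }
  have hc : Continuous φ := AddMonoidHomClass.continuous_of_bound φ ‖x‖ fun a =>
    S.norm_rsmul a x
  exact h1.map φ hc

theorem star_del_pow
    {A : Type*} {X : Type*} [NormedRing A] [NormOneClass A]
    [NormedAlgebra ℂ A] [CompleteSpace A]
    [NormedAddCommGroup X] [NormedSpace ℂ X] [CompleteSpace X]
    [Module A X] [Module Aᵐᵒᵖ X] [SMulCommClass A Aᵐᵒᵖ X]
    [IsScalarTower ℂ A X] [IsScalarTower ℂ Aᵐᵒᵖ X]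
    (S : StarSetup A X) (u : A) (hu : u ∈ S.D) (n : ℕ) :
    ‖S.del (u ^ (n + 1))‖ ≤ (n + 1) * ‖u‖ ^ n * ‖S.del u‖ := by
  induction n with
  | zero => simp
  | succ n ih =>
    rw [pow_succ u (n + 1), S.leibniz _ (S.D.pow_mem hu _) _ hu]
    have h1 : ‖u ^ (n + 1) • S.del u‖ ≤ ‖u‖ ^ (n + 1) * ‖S.del u‖ :=
      (S.norm_lsmul _ _).trans (by gcongr; exact norm_pow_le u _)
    have h2 : ‖op u • S.del (u ^ (n + 1))‖ ≤ (n + 1) * ‖u‖ ^ n * ‖S.del u‖ * ‖u‖ :=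
      (S.norm_rsmul _ _).trans (by gcongr)
    refine (norm_add_le _ _).trans ((add_le_add h1 h2).trans (le_of_eq ?_))
    push_cast; ring

theorem starSetup_geom_mem
    {A : Type*} {X : Type*} [NormedRing A] [NormOneClass A]
    [NormedAlgebra ℂ A] [CompleteSpace A]
    [NormedAddCommGroup X] [NormedSpace ℂ X] [CompleteSpace X]
    [Module A X] [Module Aᵐᵒᵖ X] [SMulCommClass A Aᵐᵒᵖ X]
    [IsScalarTower ℂ A X] [IsScalarTower ℂ Aᵐᵒᵖ X]
    (S : StarSetup A X) (u : A) (hu : u ∈ S.D) (h1 : ‖u‖ < 1) :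
    ∑' n : ℕ, u ^ n ∈ S.D := by
  have hs : Summable fun n : ℕ => S.del (u ^ n) := by
    rw [← summable_nat_add_iff 1]
    refine Summable.of_norm_bounded
      (g := fun n : ℕ => ((n : ℝ) + 1) * ‖u‖ ^ n * ‖S.del u‖) ?_ (star_del_pow S u hu)
    have hr : ‖‖u‖‖ < 1 := by rwa [norm_norm]
    have e1 := summable_pow_mul_geometric_of_norm_lt_one 1 hr
    have e2 := summable_pow_mul_geometric_of_norm_lt_one 0 hr
    refine ((e1.add e2).congr fun n => ?_).mul_right _
    ring
  exact (star_hasSum S (fun n => u ^ n) (fun n => S.D.pow_mem hu n) _ _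
    (summable_geometric_of_norm_lt_one h1).hasSum hs.hasSum).1

/-- for `f, h ∈ A₀` with `h − f` non-scalar and
`‖∂f‖ + ‖∂h‖ < min{1/3, (1 − 2‖h − f − ψ(h−f)·1‖)/M}`, there exists `g ∈ D`
invertible in the Banach algebra `D` solving the mixed gauge equation
`∂g = g·(∂f) − (∂h)·g`. -/
theorem statement11 {A : Type*} {X : Type*} [NormedRing A] [NormOneClass A]
    [NormedAlgebra ℂ A] [CompleteSpace A]
    [NormedAddCommGroup X] [NormedSpace ℂ X] [CompleteSpace X]
    [Module A X] [Module Aᵐᵒᵖ X] [SMulCommClass A Aᵐᵒᵖ X]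
    [IsScalarTower ℂ A X] [IsScalarTower ℂ Aᵐᵒᵖ X]
    (S : StarSetup A X) (f h : A) (hf : f ∈ S.A₀) (hh : h ∈ S.A₀)
    (hns : ¬ IsScalarElem (h - f))
    (hsmall : ‖S.del f‖ + ‖S.del h‖ <
      min (1 / 3) ((1 - 2 * ‖h - f - S.ψ (h - f) • (1 : A)‖) / S.M)) :
    ∃ g g' : A, g ∈ S.D ∧ g' ∈ S.D ∧ g * g' = 1 ∧ g' * g = 1 ∧
      S.del g = g • S.del f - op g • S.del h := by
  obtain ⟨-, hM⟩ := lt_min_iff.mp hsmall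
  rw [lt_div_iff₀ S.M_pos] at hM
  have hone : S.del 1 = 0 := by
    have := S.leibniz 1 S.D.one_mem 1 S.D.one_mem
    simpa using this
  have hfD := S.A₀_le hf
  have hhD := S.A₀_le hh
  set ε := ‖S.del f‖ + ‖S.del h‖ with hε
  have hε0 : 0 ≤ ε := by positivity
  set k : A := f - h - S.ψ (f - h) • (1 : A) with hk
  have hkn : ‖h - f - S.ψ (h - f) • (1 : A)‖ = ‖k‖ := by
    rw [← norm_neg]; congr 1
    rw [hk, ← neg_sub f h, map_neg, neg_smul]; abel
  rw [hkn] at hM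
  have hkD : k ∈ S.D := S.D.sub_mem (S.D.sub_mem hfD hhD) (S.D.smul_mem S.D.one_mem _)
  have hdk : S.del k = S.del f - S.del h := by
    rw [hk, map_sub, map_smul, hone, smul_zero, sub_zero, map_sub]
  let T : A → A := fun v => S.Iq (v • S.del f) - S.Iq (op v • S.del h)
  let b : ℕ → A := fun n => T^[n] k
  have hbs : ∀ n, b (n + 1) = T (b n) := fun n => Function.iterate_succ_apply' T n k
  have hbD : ∀ n, b n ∈ S.D := by
    intro n
    induction n with
    | zero => exact hkD
    | succ n ih =>
      rw [hbs]
      exact S.D.sub_mem (S.Iq_lsmul_mem f hf _ ih) (S.Iq_rsmul_mem h hh _ ih)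
  have hbdel : ∀ n, S.del (b (n + 1)) = b n • S.del f - op (b n) • S.del h := by
    intro n
    rw [hbs]
    change S.del (S.Iq _ - S.Iq _) = _
    rw [map_sub, S.del_Iq_lsmul f hf _ (hbD n), S.del_Iq_rsmul h hh _ (hbD n)]
  set q := ε * S.M with hq
  have hq0 : 0 ≤ q := mul_nonneg hε0 S.M_pos.le
  have hq1 : q < 1 := by linarith [norm_nonneg k]
  have hbn : ∀ n, ‖b n‖ ≤ ‖k‖ * q ^ n := by
    intro n
    induction n with
    | zero => simp [b]
    | succ n ih =>
      rw [hbs]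
      have h1 := S.Iq_bound _ (S.lsmul_mem_X₀ f hf _ (hbD n))
      have h2 := S.Iq_bound _ (S.rsmul_mem_X₀ h hh _ (hbD n))
      have h3 := mul_le_mul_of_nonneg_left (S.norm_lsmul (b n) (S.del f)) S.M_pos.le
      have h4 := mul_le_mul_of_nonneg_left (S.norm_rsmul (b n) (S.del h)) S.M_pos.le
      have h5 : ‖T (b n)‖ ≤ q * ‖b n‖ := by
        refine (norm_sub_le _ _).trans ?_
        rw [hq, hε]
        linarith
      refine h5.trans ((mul_le_mul_of_nonneg_left ih hq0).trans (le_of_eq ?_))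
      ring
  have hgs : Summable fun n : ℕ => ‖k‖ * q ^ n :=
    (summable_geometric_of_lt_one hq0 hq1).mul_left _
  have hbsum : Summable b := Summable.of_norm_bounded hgs hbn
  obtain ⟨v, hv⟩ := hbsum
  have hvn : ‖v‖ < 1 := by
    have h1 : ‖v‖ ≤ ‖k‖ * (1 - q)⁻¹ := by
      rw [← hv.tsum_eq]
      exact tsum_of_norm_bounded ((hasSum_geometric_of_lt_one hq0 hq1).mul_left _) hbn
    refine h1.trans_lt ?_
    rw [← div_eq_mul_inv, div_lt_one (by linarith)]
    linarith [norm_nonneg k]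
  have hdsum : HasSum (fun n => S.del (b n))
      ((v • S.del f - op v • S.del h) + S.del k) := by
    have h1 := (star_hasSum_lsmul S b v (S.del f) hv).sub
      (star_hasSum_rsmul S b v (S.del h) hv)
    have h2 : HasSum (fun n => S.del (b (n + 1))) (v • S.del f - op v • S.del h) := by
      simpa only [hbdel] using h1
    have h3 := (hasSum_nat_add_iff (f := fun n => S.del (b n)) 1).mp h2
    simpa [b] using h3
  obtain ⟨hvD, hdv⟩ := star_hasSum S b hbD v _ hv hdsum
  have hnn : ‖-v‖ < 1 := by rwa [norm_neg]
  refine ⟨1 + v, ∑' n : ℕ, (-v) ^ n, S.D.add_mem S.D.one_mem hvD,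
    starSetup_geom_mem S (-v) (S.D.neg_mem hvD) hnn, ?_, ?_, ?_⟩
  · have := mul_neg_geom_series (-v) hnn
    rwa [sub_neg_eq_add] at this
  · have := geom_series_mul_neg (-v) hnn
    rwa [sub_neg_eq_add] at this
  · rw [map_add, hone, hdv, hdk, op_add, op_one, add_smul, add_smul, one_smul, one_smul]
    abel
end

section
/- In Setup (★), let f ∈ A₀ be non-scalar with ‖∂f‖ < max{ 1/(3M), min{ 1/3, (1 − 2·‖f − ψ(f)·1‖)/M } } (norm of A in the inner expression). Then there exists g ∈ D which is invertible in the Banach algebra D (both g and g⁻¹ lie in D) and satisfies ∂g = g·(∂f). (In the model ℂP¹_q this says that the holomorphic connection ∇ⁿ_{∂̄f} is gauge equivalent to the standard connection ∇ⁿ₀ on the line bundle L_n.) -/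
open MulOpposite

theorem StarSetup.hasSum_mem {A : Type*} {X : Type*} [NormedRing A] [NormOneClass A]
    [NormedAlgebra ℂ A] [CompleteSpace A]
    [NormedAddCommGroup X] [NormedSpace ℂ X] [CompleteSpace X]
    [Module A X] [Module Aᵐᵒᵖ X] [SMulCommClass A Aᵐᵒᵖ X]
    [IsScalarTower ℂ A X] [IsScalarTower ℂ Aᵐᵒᵖ X]
    (S : StarSetup A X) (u : ℕ → A) (hu : ∀ n, u n ∈ S.D) (a : A) (x : X)
    (ha : HasSum u a) (hx : HasSum (fun n => S.del (u n)) x) :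
    a ∈ S.D ∧ S.del a = x := by
  have h := Filter.Tendsto.prodMk_nhds ha hx
  have := S.closed_graph.mem_of_tendsto h (Filter.Eventually.of_forall fun s => by
    refine ⟨S.D.sum_mem fun i _ => hu i, ?_⟩
    simp [map_sum])
  exact this

theorem StarSetup.inv_mem {A : Type*} {X : Type*} [NormedRing A] [NormOneClass A]
    [NormedAlgebra ℂ A] [CompleteSpace A]
    [NormedAddCommGroup X] [NormedSpace ℂ X] [CompleteSpace X]
    [Module A X] [Module Aᵐᵒᵖ X] [SMulCommClass A Aᵐᵒᵖ X]
    [IsScalarTower ℂ A X] [IsScalarTower ℂ Aᵐᵒᵖ X]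
    (S : StarSetup A X) (b : A) (hb : b ∈ S.D) (hb1 : ‖b‖ < 1) :
    (∑' n : ℕ, b ^ n) ∈ S.D := by
  have hs : Summable (fun n : ℕ => b ^ n) := summable_geometric_of_norm_lt_one hb1
  have hbd : ∀ n : ℕ, ‖S.del (b ^ (n + 1))‖ ≤ ((n : ℝ) + 1) * ‖b‖ ^ n * ‖S.del b‖ := by
    intro n
    induction n with
    | zero => simp
    | succ n ih =>
      rw [pow_succ' b (n + 1), S.leibniz b hb _ (S.D.pow_mem hb _)]
      calc _ ≤ ‖b • S.del (b ^ (n + 1))‖ + ‖op (b ^ (n + 1)) • S.del b‖ := norm_add_le _ _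
        _ ≤ ‖b‖ * (((n : ℝ) + 1) * ‖b‖ ^ n * ‖S.del b‖) + ‖S.del b‖ * ‖b‖ ^ (n + 1) := by
          refine add_le_add ((S.norm_lsmul _ _).trans ?_) ((S.norm_rsmul _ _).trans ?_)
          · gcongr
          · gcongr
            exact norm_pow_le _ _
        _ = _ := by push_cast; ring
  have hds : Summable (fun n : ℕ => S.del (b ^ n)) := by
    refine (summable_nat_add_iff 1).1 (Summable.of_norm_bounded ?_ hbd)
    have h1 : Summable (fun n : ℕ => (n : ℝ) ^ 1 * ‖b‖ ^ n) :=
      summable_pow_mul_geometric_of_norm_lt_one 1 (by simpa using hb1)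
    have h2 : Summable (fun n : ℕ => ‖b‖ ^ n) :=
      summable_geometric_of_lt_one (norm_nonneg _) hb1
    refine Summable.mul_right _ ((h1.add h2).congr fun n => ?_)
    ring
  exact (S.hasSum_mem _ (fun n => S.D.pow_mem hb n) _ _ hs.hasSum hds.hasSum).1

/-- for non-scalar `f ∈ A₀` with
`‖∂f‖ < max{1/(3M), min{1/3, (1 − 2‖f − ψ(f)·1‖)/M}}`, there exists `g ∈ D`
invertible in the Banach algebra `D` with `∂g = g·(∂f)`. -/
theorem statement12 {A : Type*} {X : Type*} [NormedRing A] [NormOneClass A]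
    [NormedAlgebra ℂ A] [CompleteSpace A]
    [NormedAddCommGroup X] [NormedSpace ℂ X] [CompleteSpace X]
    [Module A X] [Module Aᵐᵒᵖ X] [SMulCommClass A Aᵐᵒᵖ X]
    [IsScalarTower ℂ A X] [IsScalarTower ℂ Aᵐᵒᵖ X]
    (S : StarSetup A X) (f : A) (hf : f ∈ S.A₀) (hfns : ¬ IsScalarElem f)
    (hsmall : ‖S.del f‖ <
      max (1 / (3 * S.M)) (min (1 / 3) ((1 - 2 * ‖f - S.ψ f • (1 : A)‖) / S.M))) :
    ∃ g g' : A, g ∈ S.D ∧ g' ∈ S.D ∧ g * g' = 1 ∧ g' * g = 1 ∧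
      S.del g = g • S.del f := by
  set s := ‖f - S.ψ f • (1 : A)‖ with hs
  set r := S.M * ‖S.del f‖ with hr
  have hM := S.M_pos
  have hfD : f ∈ S.D := S.A₀_le hf
  have hs0 : 0 ≤ s := norm_nonneg _
  have hr0 : 0 ≤ r := by positivity
  have hsr : s ≤ r := by
    rw [hs, ← S.Iq_del f hfD]
    exact S.Iq_bound _ (S.del_mem_X₀ f hfD)
  have hrs : r + s < 1 := by
    rcases lt_max_iff.1 hsmall with h | h
    · rw [lt_div_iff₀ (by positivity)] at h
      nlinarith
    · have h := (lt_min_iff.1 h).2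
      rw [lt_div_iff₀ hM] at h
      nlinarith
  have hr1 : r < 1 := by linarith
  obtain ⟨t, ht0, htS⟩ : ∃ t : ℕ → A, t 0 = 1 ∧ ∀ n, t (n + 1) = S.Iq (t n • S.del f) :=
    ⟨fun n => Nat.rec (1 : A) (fun _ a => S.Iq (a • S.del f)) n, rfl, fun _ => rfl⟩
  have htD : ∀ n, t n ∈ S.D := by
    intro n
    induction n with
    | zero => rw [ht0]; exact S.D.one_mem
    | succ n ih => rw [htS]; exact S.Iq_lsmul_mem f hf _ ih
  have htd : ∀ n, S.del (t (n + 1)) = t n • S.del f := fun n => by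
    rw [htS]; exact S.del_Iq_lsmul f hf _ (htD n)
  have hd1 : S.del 1 = 0 := by
    have := S.leibniz 1 S.D.one_mem 1 S.D.one_mem
    simpa using this
  have hbd : ∀ n, ‖t (n + 1)‖ ≤ s * r ^ n := by
    intro n
    induction n with
    | zero => rw [htS, ht0, one_smul, S.Iq_del f hfD]; simp [hs]
    | succ n ih =>
      rw [htS]
      calc _ ≤ S.M * ‖t (n + 1) • S.del f‖ :=
            S.Iq_bound _ (S.lsmul_mem_X₀ f hf _ (htD _))
        _ ≤ S.M * (s * r ^ n * ‖S.del f‖) := by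
          gcongr
          exact (S.norm_lsmul _ _).trans (by gcongr)
        _ = _ := by rw [hr]; ring
  have hgeo : HasSum (fun n : ℕ => s * r ^ n) (s * (1 - r)⁻¹) :=
    (hasSum_geometric_of_lt_one hr0 hr1).mul_left s
  have hsum : Summable t :=
    (summable_nat_add_iff 1).1 (Summable.of_norm_bounded hgeo.summable hbd)
  obtain ⟨g, hg⟩ := hsum
  have hg1 : HasSum (fun n => t (n + 1)) (g - 1) := by
    have := (hasSum_nat_add_iff' 1).2 hg
    simpa [ht0] using this
  have hnorm : ‖g - 1‖ < 1 := by
    have h : ‖g - 1‖ ≤ s * (1 - r)⁻¹ := by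
      rw [← hg1.tsum_eq]
      exact tsum_of_norm_bounded hgeo hbd
    refine h.trans_lt ?_
    rw [← div_eq_mul_inv, div_lt_one (by linarith)]
    linarith
  let L : A →ₗ[ℂ] X :=
    { toFun := fun a => a • S.del f
      map_add' := fun a b => add_smul a b _
      map_smul' := fun c a => smul_assoc c a _ }
  let L' : A →L[ℂ] X := L.mkContinuous ‖S.del f‖ fun a => by
    rw [mul_comm]; exact S.norm_lsmul a _
  have hL : HasSum (fun n => t n • S.del f) (g • S.del f) := L'.hasSum hg
  have hdel : HasSum (fun n => S.del (t n)) (g • S.del f) := by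
    refine (hasSum_nat_add_iff' 1).1 ?_
    simpa [ht0, hd1, htd] using hL
  obtain ⟨hgD, hgd⟩ := S.hasSum_mem t htD g _ hg hdel
  have hb1 : ‖1 - g‖ < 1 := by rwa [norm_sub_rev]
  have hbs : Summable (fun n : ℕ => (1 - g) ^ n) := summable_geometric_of_norm_lt_one hb1
  refine ⟨g, ∑' n : ℕ, (1 - g) ^ n, hgD,
    S.inv_mem (1 - g) (S.D.sub_mem S.D.one_mem hgD) hb1, ?_, ?_, hgd⟩
  · simpa using mul_neg_geom_series (1 - g) hb1
  · simpa using geom_series_mul_neg (1 - g) hb1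
end

section
/- In Setup (★), let f, h ∈ A₀, set L_{f,h}(v) := ∂v − v·(∂f) + (∂h)·v for v ∈ D, β_{f,h} := ∂(h − f) ∈ X₀, and define Φ_{f,h} : H → H by Φ_{f,h}(v) := I(v·(∂f) − (∂h)·v + β_{f,h}). Then Φ_{f,h} is well defined, and Φ_{f,h} has a fixed point in H if and only if β_{f,h} belongs to the image L_{f,h}(H) of H under L_{f,h}. -/
open MulOpposite

/-- with `L_{f,h}(v) := ∂v − v·(∂f) + (∂h)·v`,
`β_{f,h} := ∂(h − f)` and `Φ_{f,h}(v) := I(v·(∂f) − (∂h)·v + β_{f,h})`,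
the map `Φ_{f,h}` is well defined `H → H`, and it has a fixed point in `H`
iff `β_{f,h} ∈ L_{f,h}(H)`. -/
theorem statement14 {A : Type*} {X : Type*} [NormedRing A] [NormOneClass A]
    [NormedAlgebra ℂ A] [CompleteSpace A]
    [NormedAddCommGroup X] [NormedSpace ℂ X] [CompleteSpace X]
    [Module A X] [Module Aᵐᵒᵖ X] [SMulCommClass A Aᵐᵒᵖ X]
    [IsScalarTower ℂ A X] [IsScalarTower ℂ Aᵐᵒᵖ X]
    (S : StarSetup A X) (f h : A) (hf : f ∈ S.A₀) (hh : h ∈ S.A₀) :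
    -- Φ_{f,h} is well defined on H
    (∀ v ∈ S.Hs, S.Iq (v • S.del f - op v • S.del h + S.del (h - f)) ∈ S.Hs) ∧
    -- fixed-point criterion: Φ_{f,h} has a fixed point iff β_{f,h} ∈ L_{f,h}(H)
    ((∃ v ∈ S.Hs, S.Iq (v • S.del f - op v • S.del h + S.del (h - f)) = v) ↔
      (∃ v ∈ S.Hs, S.del v - v • S.del f + op v • S.del h = S.del (h - f))) := by
  have hb : h - f ∈ S.A₀ := S.A₀.sub_mem hh hf
  have h1 : (1 : A) ∈ S.D := S.D.one_mem
  have bD : S.Iq (S.del (h - f)) ∈ S.D := by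
    simpa using S.Iq_lsmul_mem _ hb 1 h1
  have bdel : S.del (S.Iq (S.del (h - f))) = S.del (h - f) := by
    simpa only [one_smul] using S.del_Iq_lsmul _ hb 1 h1
  have bψ : S.ψ (S.Iq (S.del (h - f))) = 0 := by
    simpa only [one_smul] using S.ψ_Iq_lsmul _ hb 1 h1
  refine ⟨?_, ?_, ?_⟩
  · rintro v ⟨hv, -⟩
    rw [S.Iq.map_add, S.Iq.map_sub]
    refine ⟨S.D.add_mem (S.D.sub_mem (S.Iq_lsmul_mem f hf v hv)
      (S.Iq_rsmul_mem h hh v hv)) bD, ?_⟩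
    rw [map_add, map_sub, S.ψ_Iq_lsmul f hf v hv, S.ψ_Iq_rsmul h hh v hv, bψ]
    simp
  · rintro ⟨v, ⟨hv, hψ⟩, hfix⟩
    refine ⟨v, ⟨hv, hψ⟩, ?_⟩
    have e := congrArg S.del hfix
    rw [S.Iq.map_add, S.Iq.map_sub, S.del.map_add, S.del.map_sub,
      S.del_Iq_lsmul f hf v hv, S.del_Iq_rsmul h hh v hv, bdel] at e
    rw [← e]
    abel
  · rintro ⟨v, ⟨hv, hψ⟩, hL⟩
    refine ⟨v, ⟨hv, hψ⟩, ?_⟩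
    have e : v • S.del f - op v • S.del h + S.del (h - f) = S.del v := by
      rw [← hL]
      abel
    rw [e, S.Iq_del v hv, hψ, zero_smul, sub_zero]
end

section
/- In Setup (★), assume additionally ker ∂ = ℂ·1. Let f, h ∈ A₀ with h − f non-scalar; set w := h − f − ψ(h − f)·1 ∈ D, let L_{f,h} : D → X be L_{f,h}(v) := ∂v − v·(∂f) + (∂h)·v with operator norm ‖L_{f,h}‖ from (D, ‖·‖_Gr) to X, and Φ_{f,h}(v) := I(v·(∂f) − (∂h)·v + ∂(h − f)) for v ∈ H. Then ‖L_{f,h}‖ > 0, and for every v ∈ H one has ‖Φ_{f,h}(v) − v‖_Gr ≥ ‖w‖_Gr − (M+1)·‖L_{f,h}‖·‖v‖_Gr. In particular, every fixed point v ∈ H of Φ_{f,h} satisfies ‖v‖_Gr ≥ ‖w‖_Gr / ((M+1)·‖L_{f,h}‖). -/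
open MulOpposite

namespace StarSetup

variable {A : Type*} {X : Type*} [NormedRing A] [NormOneClass A]
    [NormedAlgebra ℂ A] [CompleteSpace A]
    [NormedAddCommGroup X] [NormedSpace ℂ X] [CompleteSpace X]
    [Module A X] [Module Aᵐᵒᵖ X] [SMulCommClass A Aᵐᵒᵖ X]
    [IsScalarTower ℂ A X] [IsScalarTower ℂ Aᵐᵒᵖ X]

/-- the operator `L_{f,h}(v) := ∂v − v·(∂f) + (∂h)·v` -/
noncomputable def Lop (S : StarSetup A X) (f h v : A) : X :=
  S.del v - v • S.del f + op v • S.del h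

/-- the operator norm of `L_{f,h}` from `(D, ‖·‖_Gr)` to `X` -/
noncomputable def LopNorm (S : StarSetup A X) (f h : A) : ℝ :=
  sSup {r : ℝ | ∃ v ∈ S.D, S.Gr v ≤ 1 ∧ r = ‖S.Lop f h v‖}

/-- the map `Φ_{f,h}(v) := I(v·(∂f) − (∂h)·v + ∂(h − f))` -/
noncomputable def Phi (S : StarSetup A X) (f h v : A) : A :=
  S.Iq (v • S.del f - op v • S.del h + S.del (h - f))

end StarSetup

/-- assuming `ker ∂ = ℂ·1`, for `f, h ∈ A₀` with `h − f`
non-scalar and `w := h − f − ψ(h−f)·1`, one has `‖L_{f,h}‖ > 0`, for every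
`v ∈ H` the estimate `‖Φ_{f,h}(v) − v‖_Gr ≥ ‖w‖_Gr − (M+1)‖L_{f,h}‖‖v‖_Gr`
holds, and every fixed point `v ∈ H` of `Φ_{f,h}` satisfies
`‖v‖_Gr ≥ ‖w‖_Gr/((M+1)‖L_{f,h}‖)`. -/
theorem statement15 {A : Type*} {X : Type*} [NormedRing A] [NormOneClass A]
    [NormedAlgebra ℂ A] [CompleteSpace A]
    [NormedAddCommGroup X] [NormedSpace ℂ X] [CompleteSpace X]
    [Module A X] [Module Aᵐᵒᵖ X] [SMulCommClass A Aᵐᵒᵖ X]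
    [IsScalarTower ℂ A X] [IsScalarTower ℂ Aᵐᵒᵖ X]
    (S : StarSetup A X)
    (hker : {a : A | a ∈ S.D ∧ S.del a = 0} = {a : A | IsScalarElem a})
    (f h : A) (hf : f ∈ S.A₀) (hh : h ∈ S.A₀)
    (hns : ¬ IsScalarElem (h - f)) :
    0 < S.LopNorm f h ∧
    (∀ v ∈ S.Hs,
      S.Gr (h - f - S.ψ (h - f) • (1 : A)) - (S.M + 1) * S.LopNorm f h * S.Gr v ≤
        S.Gr (S.Phi f h v - v)) ∧
    (∀ v ∈ S.Hs, S.Phi f h v = v →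
      S.Gr (h - f - S.ψ (h - f) • (1 : A)) / ((S.M + 1) * S.LopNorm f h) ≤ S.Gr v) := by
  have hfD : f ∈ S.D := S.A₀_le hf
  have hhD : h ∈ S.D := S.A₀_le hh
  have hD : h - f ∈ S.D := sub_mem hhD hfD
  have hone : S.del 1 = 0 := by
    have h1 : (1 : A) ∈ {a : A | a ∈ S.D ∧ S.del a = 0} := by
      rw [hker]; exact ⟨1, by simp⟩
    exact h1.2
  have hne : S.del (h - f) ≠ 0 := by
    intro h0
    have h1 : (h - f) ∈ {a : A | a ∈ S.D ∧ S.del a = 0} := ⟨hD, h0⟩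
    rw [hker] at h1
    exact hns h1
  have hbd : ∀ v, ‖S.Lop f h v‖ ≤ (1 + ‖S.del f‖ + ‖S.del h‖) * S.Gr v := by
    intro v
    have h1 := S.norm_lsmul v (S.del f)
    have h2 := S.norm_rsmul v (S.del h)
    have h3 : ‖S.Lop f h v‖ ≤ ‖S.del v‖ + ‖v • S.del f‖ + ‖op v • S.del h‖ := by
      unfold StarSetup.Lop
      exact (norm_add_le _ _).trans (by gcongr; exact norm_sub_le _ _)
    unfold StarSetup.Gr
    have := norm_nonneg v
    have := mul_nonneg (norm_nonneg (S.del f)) (norm_nonneg (S.del v))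
    have := mul_nonneg (norm_nonneg (S.del h)) (norm_nonneg (S.del v))
    nlinarith
  have hBdd : BddAbove {r : ℝ | ∃ v ∈ S.D, S.Gr v ≤ 1 ∧ r = ‖S.Lop f h v‖} := by
    refine ⟨1 + ‖S.del f‖ + ‖S.del h‖, ?_⟩
    rintro r ⟨v, -, hv, rfl⟩
    exact (hbd v).trans (mul_le_of_le_one_right (by positivity) hv)
  have hpos : 0 < S.LopNorm f h := by
    have h1 : S.Lop f h 1 = S.del (h - f) := by
      simp [StarSetup.Lop, hone]; abel
    have h2 : ‖S.Lop f h 1‖ ≤ S.LopNorm f h :=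
      le_csSup hBdd ⟨1, one_mem _, by simp [StarSetup.Gr, hone], rfl⟩
    rw [h1] at h2
    exact (norm_pos_iff.mpr hne).trans_le h2
  have hL : ∀ v ∈ S.D, ‖S.Lop f h v‖ ≤ S.LopNorm f h * S.Gr v := by
    intro v hv
    have hG0 : 0 ≤ S.Gr v := by unfold StarSetup.Gr; positivity
    rcases hG0.eq_or_lt with h0 | h0
    · have := hbd v
      rw [← h0] at this ⊢
      simpa using this
    · have hsm : ∀ c : ℂ, S.Lop f h (c • v) = c • S.Lop f h v := by
        intro c
        simp only [StarSetup.Lop, map_smul, smul_assoc, op_smul, smul_add, smul_sub]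
      have hcn : ‖(((S.Gr v)⁻¹ : ℝ) : ℂ)‖ = (S.Gr v)⁻¹ := by
        rw [Complex.norm_real, Real.norm_of_nonneg (by positivity)]
      have h2 : ‖S.Lop f h ((((S.Gr v)⁻¹ : ℝ) : ℂ) • v)‖ ≤ S.LopNorm f h := by
        refine le_csSup hBdd ⟨_, S.D.smul_mem hv _, ?_, rfl⟩
        have : S.Gr ((((S.Gr v)⁻¹ : ℝ) : ℂ) • v) = (S.Gr v)⁻¹ * S.Gr v := by
          have hG : ∀ c : ℂ, S.Gr (c • v) = ‖c‖ * S.Gr v := by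
            intro c
            simp only [StarSetup.Gr, map_smul, norm_smul, mul_add]
          rw [hG, hcn]
        rw [this, inv_mul_cancel₀ h0.ne']
      rw [hsm, norm_smul, hcn, inv_mul_le_iff₀ h0] at h2
      linarith
  have hmain : ∀ v ∈ S.Hs,
      S.Gr (h - f - S.ψ (h - f) • (1 : A)) - (S.M + 1) * S.LopNorm f h * S.Gr v ≤
        S.Gr (S.Phi f h v - v) := by
    rintro v ⟨hv, hψ⟩
    have hIv : S.Iq (S.del v) = v := by rw [S.Iq_del v hv, hψ]; simp
    have hw := S.Iq_del (h - f) hD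
    set w := h - f - S.ψ (h - f) • (1 : A) with hwdef
    have hIL : S.Iq (S.Lop f h v)
        = v - S.Iq (v • S.del f) + S.Iq (op v • S.del h) := by
      simp only [StarSetup.Lop, map_add, map_sub]
      rw [hIv]
    have hmem : S.Lop f h v ∈ S.X₀ :=
      add_mem (sub_mem (S.del_mem_X₀ v hv) (S.lsmul_mem_X₀ f hf v hv))
        (S.rsmul_mem_X₀ h hh v hv)
    have hdIL : S.del (S.Iq (S.Lop f h v)) = S.Lop f h v := by
      rw [hIL, map_add, map_sub, S.del_Iq_lsmul f hf v hv, S.del_Iq_rsmul h hh v hv]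
      rfl
    have hPhi : S.Phi f h v - v = w - S.Iq (S.Lop f h v) := by
      rw [hIL, StarSetup.Phi, map_add, hw, map_sub]
      abel
    have hb := S.Iq_bound _ hmem
    have hLv := hL v hv
    have h1 := norm_sub_norm_le w (S.Iq (S.Lop f h v))
    have h2 := norm_sub_norm_le (S.del w) (S.Lop f h v)
    have h3 : (S.M + 1) * ‖S.Lop f h v‖ ≤ (S.M + 1) * (S.LopNorm f h * S.Gr v) :=
      mul_le_mul_of_nonneg_left hLv (by linarith [S.M_pos])
    have h4 : S.Gr (S.Phi f h v - v)
        = ‖w - S.Iq (S.Lop f h v)‖ + ‖S.del w - S.Lop f h v‖ := by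
      rw [hPhi, StarSetup.Gr, map_sub, hdIL]
    have h5 : S.Gr w = ‖w‖ + ‖S.del w‖ := rfl
    rw [h4, h5]
    nlinarith
  refine ⟨hpos, hmain, ?_⟩
  intro v hv hfix
  have h1 := hmain v hv
  have h0 : S.Gr (S.Phi f h v - v) = 0 := by simp [hfix, StarSetup.Gr]
  have hM := S.M_pos
  rw [h0] at h1
  rw [div_le_iff₀ (by positivity)]
  linarith
end

section
/- In Setup (★), let f, h ∈ A₀ with h − f non-scalar, and for each λ ∈ ℂ define Φ_{f,h,λ} : H → H by Φ_{f,h,λ}(v) := I(v·(∂f) − (∂h)·v + λ·∂(h − f)). Then the following are equivalent: (a) there exists g ∈ D, invertible in the Banach algebra D, satisfying the mixed gauge equation ∂g = g·(∂f) − (∂h)·g; (b) there exist λ₀ ∈ ℂ and ξ ∈ H with ‖ξ‖_Gr < 1 such that Φ_{f,h,λ₀}(ξ) = ξ and λ₀·1 − ξ is invertible in D. Moreover, when (a) holds, the λ₀ in (b) can be chosen to satisfy |λ₀| < 1. (This is the necessary and sufficient fixed-point criterion for gauge equivalence of the holomorphic connections ∇ⁿ_{∂̄f} and ∇ⁿ_{∂̄h}.)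 -/
open MulOpposite

/-- main theorem: for `f, h ∈ A₀` with `h − f` non-scalar and
`Φ_{f,h,λ}(v) := I(v·(∂f) − (∂h)·v + λ·∂(h − f))`, the following are
equivalent: (a) there is `g ∈ D` invertible in the Banach algebra `D` solving
the mixed gauge equation `∂g = g·(∂f) − (∂h)·g`; (b) there are `λ₀ ∈ ℂ` and
`ξ ∈ H` with `‖ξ‖_Gr < 1` such that `Φ_{f,h,λ₀}(ξ) = ξ` and `λ₀·1 − ξ` is
invertible in `D`. Moreover, when (a) holds, `λ₀` can be chosen with
`|λ₀| < 1`. -/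
theorem statement16 {A : Type*} {X : Type*} [NormedRing A] [NormOneClass A]
    [NormedAlgebra ℂ A] [CompleteSpace A]
    [NormedAddCommGroup X] [NormedSpace ℂ X] [CompleteSpace X]
    [Module A X] [Module Aᵐᵒᵖ X] [SMulCommClass A Aᵐᵒᵖ X]
    [IsScalarTower ℂ A X] [IsScalarTower ℂ Aᵐᵒᵖ X]
    (S : StarSetup A X) (f h : A) (hf : f ∈ S.A₀) (hh : h ∈ S.A₀)
    (hns : ¬ IsScalarElem (h - f)) :
    -- (a) ↔ (b)
    ((∃ g g' : A, g ∈ S.D ∧ g' ∈ S.D ∧ g * g' = 1 ∧ g' * g = 1 ∧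
        S.del g = g • S.del f - op g • S.del h) ↔
      (∃ l₀ : ℂ, ∃ ξ ∈ S.Hs, S.Gr ξ < 1 ∧
        S.Iq (ξ • S.del f - op ξ • S.del h + l₀ • S.del (h - f)) = ξ ∧
        ∃ y ∈ S.D, (l₀ • (1 : A) - ξ) * y = 1 ∧ y * (l₀ • (1 : A) - ξ) = 1)) ∧
    -- moreover λ₀ can be chosen with |λ₀| < 1
    ((∃ g g' : A, g ∈ S.D ∧ g' ∈ S.D ∧ g * g' = 1 ∧ g' * g = 1 ∧
        S.del g = g • S.del f - op g • S.del h) →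
      ∃ l₀ : ℂ, ‖l₀‖ < 1 ∧ ∃ ξ ∈ S.Hs, S.Gr ξ < 1 ∧
        S.Iq (ξ • S.del f - op ξ • S.del h + l₀ • S.del (h - f)) = ξ ∧
        ∃ y ∈ S.D, (l₀ • (1 : A) - ξ) * y = 1 ∧ y * (l₀ • (1 : A) - ξ) = 1) := by
  have hfD : f ∈ S.D := S.A₀_le hf
  have hhD : h ∈ S.D := S.A₀_le hh
  have hdel1 : S.del 1 = 0 := by
    have h1 := S.leibniz 1 S.D.one_mem 1 S.D.one_mem
    rw [mul_one, op_one, one_smul, one_smul] at h1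
    simpa using h1
  have hsl : ∀ (c : ℂ) (x : X), (c • (1 : A)) • x = c • x := by
    intro c x
    rw [smul_assoc, one_smul]
  have hsr : ∀ (c : ℂ) (x : X), op (c • (1 : A)) • x = c • x := by
    intro c x
    rw [op_smul, smul_assoc, op_one, one_smul]
  have key : (∃ g g' : A, g ∈ S.D ∧ g' ∈ S.D ∧ g * g' = 1 ∧ g' * g = 1 ∧
        S.del g = g • S.del f - op g • S.del h) →
      ∃ l₀ : ℂ, ‖l₀‖ < 1 ∧ ∃ ξ ∈ S.Hs, S.Gr ξ < 1 ∧
        S.Iq (ξ • S.del f - op ξ • S.del h + l₀ • S.del (h - f)) = ξ ∧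
        ∃ y ∈ S.D, (l₀ • (1 : A) - ξ) * y = 1 ∧ y * (l₀ • (1 : A) - ξ) = 1 := by
    rintro ⟨g, g', hg, hg', h1, h2, hde⟩
    set η : A := S.ψ g • (1 : A) - g with hη
    have hη_mem : η ∈ S.D := S.D.sub_mem (S.D.smul_mem S.D.one_mem _) hg
    have hη_ψ : S.ψ η = 0 := by simp [hη]
    have hη_eq : η • S.del f - op η • S.del h + S.ψ g • S.del (h - f) = S.del η := by
      rw [hη, op_sub, sub_smul, sub_smul, hsl, hsr, map_sub, map_sub, map_smul, hdel1, hde,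
        smul_sub, smul_zero]
      abel
    set r : ℝ := (1 + S.Gr η + ‖S.ψ g‖) with hr
    have hGr : 0 ≤ S.Gr η := add_nonneg (norm_nonneg _) (norm_nonneg _)
    have hψn := norm_nonneg (S.ψ g)
    have hr0 : 0 < r := by linarith
    set t : ℂ := ((r⁻¹ : ℝ) : ℂ) with ht
    have htn : ‖t‖ = r⁻¹ := by
      rw [ht, Complex.norm_real, Real.norm_of_nonneg (inv_nonneg.2 hr0.le)]
    have ht0 : t ≠ 0 := by
      rw [← norm_ne_zero_iff, htn]; exact inv_ne_zero hr0.ne'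
    have hsub : (t * S.ψ g) • (1 : A) - t • η = t • g := by
      rw [hη, smul_sub, smul_smul]; abel
    refine ⟨t * S.ψ g, ?_, t • η, ⟨S.D.smul_mem hη_mem _, ?_⟩, ?_, ?_, t⁻¹ • g',
      S.D.smul_mem hg' _, ?_, ?_⟩
    · rw [norm_mul, htn, inv_mul_lt_iff₀ hr0]; linarith
    · rw [map_smul, hη_ψ, smul_zero]
    · have : S.Gr (t • η) = r⁻¹ * S.Gr η := by
        simp only [StarSetup.Gr, map_smul, norm_smul, htn]; ring
      rw [this, inv_mul_lt_iff₀ hr0]; linarith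
    · have : (t • η) • S.del f - op (t • η) • S.del h + (t * S.ψ g) • S.del (h - f)
          = t • S.del η := by
        rw [← hη_eq, op_smul, smul_assoc, smul_assoc, mul_smul, smul_add, smul_sub]
      rw [this, map_smul, S.Iq_del η hη_mem, hη_ψ, zero_smul, sub_zero]
    · rw [hsub, smul_mul_smul_comm, h1, mul_inv_cancel₀ ht0, one_smul]
    · rw [hsub, smul_mul_smul_comm, h2, inv_mul_cancel₀ ht0, one_smul]
  refine ⟨⟨fun ha => ?_, ?_⟩, key⟩
  · obtain ⟨l, -, hl⟩ := key ha
    exact ⟨l, hl⟩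
  · rintro ⟨l, ξ, ⟨hξD, -⟩, -, hfix, y, hy, h1, h2⟩
    refine ⟨l • (1 : A) - ξ, y, S.D.sub_mem (S.D.smul_mem S.D.one_mem _) hξD, hy, h1, h2, ?_⟩
    have hd : S.del ξ = ξ • S.del f - op ξ • S.del h + l • S.del (h - f) := by
      conv_lhs => rw [← hfix]
      rw [map_add, map_sub, map_smul S.Iq l, S.Iq_del _ (S.D.sub_mem hhD hfD), map_add, map_sub,
        S.del_Iq_lsmul f hf ξ hξD, S.del_Iq_rsmul h hh ξ hξD, map_smul S.del l, map_sub S.del (h - f),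
        map_smul, hdel1, smul_zero, sub_zero]
    rw [map_sub, map_smul, hdel1, hd, op_sub, sub_smul, sub_smul, hsl, hsr, map_sub, smul_sub,
      smul_zero]
    abel
end

section
/- In Setup (★), let f, h ∈ A₀, set L_{f,h}(v) := ∂v − v·(∂f) + (∂h)·v for v ∈ D, β_{f,h} := ∂(h − f) ∈ X₀, and Φ_{f,h}(v) := I(v·(∂f) − (∂h)·v + β_{f,h}) for v ∈ H. Suppose the pair (f, h) is admissible, i.e. there exists a continuous linear functional ℓ on X₀ that vanishes on the norm-closure of L_{f,h}(H) and satisfies ℓ(β_{f,h}) ≠ 0. Then Φ_{f,h} has no fixed point in H. Moreover, for every nonzero continuous linear functional ℓ on X₀ vanishing on the norm-closure of L_{f,h}(H), one has dist(β_{f,h}, closure of L_{f,h}(H)) ≥ |ℓ(β_{f,h})| / ‖ℓ‖. -/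
open MulOpposite

namespace StarSetup

variable {A : Type*} {X : Type*} [NormedRing A] [NormOneClass A]
    [NormedAlgebra ℂ A] [CompleteSpace A]
    [NormedAddCommGroup X] [NormedSpace ℂ X] [CompleteSpace X]
    [Module A X] [Module Aᵐᵒᵖ X] [SMulCommClass A Aᵐᵒᵖ X]
    [IsScalarTower ℂ A X] [IsScalarTower ℂ Aᵐᵒᵖ X]

/-- the image `L_{f,h}(H)`, regarded as a subset of the closed subspace `X₀`,
where `L_{f,h}(v) := ∂v − v·(∂f) + (∂h)·v` -/
def LopRange (S : StarSetup A X) (f h : A) : Set S.X₀ :=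
  {x : S.X₀ | ∃ v ∈ S.Hs, (x : X) = S.del v - v • S.del f + op v • S.del h}

end StarSetup

/-- if the pair `(f,h)` is admissible, i.e. some continuous
linear functional `ℓ` on `X₀` vanishes on the norm-closure of `L_{f,h}(H)`
while `ℓ(β_{f,h}) ≠ 0` for `β_{f,h} := ∂(h − f)`, then `Φ_{f,h}` has no fixed
point in `H`; moreover every nonzero continuous linear functional `ℓ` on `X₀`
vanishing on the closure of `L_{f,h}(H)` gives the distance estimate
`dist(β_{f,h}, closure L_{f,h}(H)) ≥ |ℓ(β_{f,h})|/‖ℓ‖`. -/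
theorem statement17 {A : Type*} {X : Type*} [NormedRing A] [NormOneClass A]
    [NormedAlgebra ℂ A] [CompleteSpace A]
    [NormedAddCommGroup X] [NormedSpace ℂ X] [CompleteSpace X]
    [Module A X] [Module Aᵐᵒᵖ X] [SMulCommClass A Aᵐᵒᵖ X]
    [IsScalarTower ℂ A X] [IsScalarTower ℂ Aᵐᵒᵖ X]
    (S : StarSetup A X) (f h : A) (hf : f ∈ S.A₀) (hh : h ∈ S.A₀)
    (hβ : S.del (h - f) ∈ S.X₀) :
    -- admissibility implies no fixed point in H
    ((∃ ℓ : S.X₀ →L[ℂ] ℂ,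
        (∀ x ∈ closure (S.LopRange f h), ℓ x = 0) ∧
        ℓ ⟨S.del (h - f), hβ⟩ ≠ 0) →
      ¬ ∃ v ∈ S.Hs, S.Phi f h v = v) ∧
    -- the distance estimate
    (∀ ℓ : S.X₀ →L[ℂ] ℂ, ℓ ≠ 0 →
      (∀ x ∈ closure (S.LopRange f h), ℓ x = 0) →
      ‖ℓ ⟨S.del (h - f), hβ⟩‖ / ‖ℓ‖ ≤
        Metric.infDist (⟨S.del (h - f), hβ⟩ : S.X₀) (closure (S.LopRange f h))) := by
  have h1 : S.del 1 = 0 := by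
    have := S.leibniz 1 S.D.one_mem 1 S.D.one_mem
    simpa using this
  have hD : h - f ∈ S.D := S.D.sub_mem (S.A₀_le hh) (S.A₀_le hf)
  refine ⟨?_, ?_⟩
  · rintro ⟨ℓ, hℓ, hne⟩ ⟨v, hv, hfix⟩
    apply hne
    apply hℓ
    apply subset_closure
    refine ⟨v, hv, ?_⟩
    have e : S.del v = v • S.del f - op v • S.del h + S.del (h - f) := by
      conv_lhs => rw [← hfix]
      unfold StarSetup.Phi
      rw [map_add, map_sub, map_add, map_sub, S.del_Iq_lsmul f hf v hv.1,
        S.del_Iq_rsmul h hh v hv.1, S.Iq_del _ hD, map_sub S.del (h - f), map_smul S.del, h1,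
        smul_zero, sub_zero]
    change S.del (h - f) = _
    rw [e]
    abel
  · intro ℓ hℓ0 hℓ
    have hpos : 0 < ‖ℓ‖ := by
      refine lt_of_le_of_ne ℓ.opNorm_nonneg fun h0 => hℓ0 ?_
      ext x
      have hx := ℓ.le_opNorm x
      rw [← h0, zero_mul] at hx
      simpa using hx
    have hne : (closure (S.LopRange f h)).Nonempty := by
      refine ⟨0, subset_closure ⟨0, ⟨S.D.zero_mem, map_zero _⟩, ?_⟩⟩
      simp
    rw [Metric.le_infDist hne]
    intro y hy
    rw [div_le_iff₀ hpos, dist_eq_norm, mul_comm]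
    have := ℓ.le_opNorm ((⟨S.del (h - f), hβ⟩ : S.X₀) - y)
    rwa [map_sub, hℓ y hy, sub_zero] at this
end
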